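/- arXiv:0908.1060 — 8 statements merged into one kernel-verified Lean document; each statement's English description precedes it below -/
import Mathlib

section
/- Assume F satisfies (F1) and (F2). Then there exists a continuous function G : ℝ³ × [a,b] → ℝ such that for all (m,p,u,q,t) one has F(m,p,u,t) = q if and only if m = G(p,u,q,t); moreover G is Lipschitz continuous in (p,u,q) uniformly in t (one may take |G(p,u,q,t) − G(p',u',q',t)| ≤ (1/λ)|q−q'| + (γ/λ)|p−p'| + (δ/λ)|u−u'|), and for each fixed (p,u,t) the map q ↦ G(p,u,q,t) is monotone increasing. -/
open Set

/-- Under (F1)-(F2) one can solve the equation `F(m,p,u,t) = q` for `m`,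
obtaining a continuous function `G` which is Lipschitz in `(p,u,q)` uniformly in `t`
(with the explicit constants `1/λ`, `γ/λ`, `δ/λ`) and monotone increasing in `q`. -/
theorem stmt_0
    (a b lam Lam gam del : ℝ) (hab : a < b)
    (hlam : 0 < lam) (hLam : lam ≤ Lam) (hgam : 0 < gam) (hdel : 0 < del)
    (F : ℝ → ℝ → ℝ → ℝ → ℝ)
    (hFcont : ContinuousOn (fun z : ℝ × ℝ × ℝ × ℝ => F z.1 z.2.1 z.2.2.1 z.2.2.2)
      {z : ℝ × ℝ × ℝ × ℝ | z.2.2.2 ∈ Icc a b})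
    (hF1 : ∀ s : ℝ, 0 ≤ s → ∀ m p u : ℝ, ∀ t ∈ Icc a b,
      F (s * m) (s * p) (s * u) t = s * F m p u t)
    (hF2 : ∀ m p u m' p' u' : ℝ, ∀ t ∈ Icc a b,
      lam * max (m - m') 0 - Lam * max (-(m - m')) 0 - gam * |p - p'| - del * |u - u'|
          ≤ F m p u t - F m' p' u' t ∧
        F m p u t - F m' p' u' t
          ≤ Lam * max (m - m') 0 - lam * max (-(m - m')) 0 + gam * |p - p'| + del * |u - u'|) :
    ∃ G : ℝ → ℝ → ℝ → ℝ → ℝ,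
      ContinuousOn (fun z : ℝ × ℝ × ℝ × ℝ => G z.1 z.2.1 z.2.2.1 z.2.2.2)
        {z : ℝ × ℝ × ℝ × ℝ | z.2.2.2 ∈ Icc a b} ∧
      (∀ m p u q : ℝ, ∀ t ∈ Icc a b, (F m p u t = q ↔ m = G p u q t)) ∧
      (∀ p u q p' u' q' : ℝ, ∀ t ∈ Icc a b,
        |G p u q t - G p' u' q' t| ≤
          (1 / lam) * |q - q'| + (gam / lam) * |p - p'| + (del / lam) * |u - u'|) ∧
      (∀ p u : ℝ, ∀ t ∈ Icc a b, Monotone fun q => G p u q t) := by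
  have coercive : ∀ m p u m' p' u' : ℝ, ∀ t ∈ Icc a b,
      lam * |m - m'| ≤ |F m p u t - F m' p' u' t| + gam * |p - p'| + del * |u - u'| := by
    intro m p u m' p' u' t ht
    obtain ⟨h1, h2⟩ := hF2 m p u m' p' u' t ht
    rcases le_total 0 (m - m') with h | h
    · rw [max_eq_left h, max_eq_right (by linarith)] at h1
      rw [abs_of_nonneg h]
      linarith [le_abs_self (F m p u t - F m' p' u' t)]
    · rw [max_eq_right h, max_eq_left (by linarith)] at h2
      rw [abs_of_nonpos h]
      linarith [neg_abs_le (F m p u t - F m' p' u' t)]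
  have solvable : ∀ p u q t : ℝ, ∃ m, t ∈ Icc a b → F m p u t = q := by
    intro p u q t
    by_cases ht : t ∈ Icc a b
    · have hcont : Continuous fun m => F m p u t :=
        hFcont.comp_continuous (f := fun m : ℝ => (m, p, u, t)) (by fun_prop) fun _ => ht
      set c := |q - F 0 p u t| / lam with hc
      have hc0 : 0 ≤ c := by positivity
      have hlc : lam * c = |q - F 0 p u t| := by rw [hc]; field_simp
      have hhi := (hF2 c p u 0 p u t ht).1
      have hlo := (hF2 (-c) p u 0 p u t ht).2
      rw [max_eq_left (by linarith), max_eq_right (by linarith)] at hhi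
      rw [max_eq_right (by linarith), max_eq_left (by linarith)] at hlo
      simp only [sub_self, abs_zero, mul_zero, sub_zero, neg_neg, add_zero, zero_sub] at hhi hlo
      obtain ⟨m, -, hm⟩ := intermediate_value_Icc (show -c ≤ c by linarith) hcont.continuousOn
        (show q ∈ Icc (F (-c) p u t) (F c p u t) from
          ⟨by linarith [neg_abs_le (q - F 0 p u t)], by linarith [le_abs_self (q - F 0 p u t)]⟩)
      exact ⟨m, fun _ => hm⟩
    · exact ⟨0, fun h => absurd h ht⟩
  choose G hG using solvable
  refine ⟨G, ?_, ?_, ?_, ?_⟩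
  · rintro ⟨p₀, u₀, q₀, t₀⟩ ht₀
    set S := {z : ℝ × ℝ × ℝ × ℝ | z.2.2.2 ∈ Icc a b}
    set m₀ := G p₀ u₀ q₀ t₀ with hm₀
    have hFt : ContinuousOn (fun z : ℝ × ℝ × ℝ × ℝ => F m₀ p₀ u₀ z.2.2.2) S :=
      hFcont.comp (f := fun z : ℝ × ℝ × ℝ × ℝ => (m₀, p₀, u₀, z.2.2.2)) (by fun_prop)
        fun _ hz => hz
    have hbound : ContinuousOn (fun z : ℝ × ℝ × ℝ × ℝ =>
        (|z.2.2.1 - F m₀ p₀ u₀ z.2.2.2| + gam * |z.1 - p₀| + del * |z.2.1 - u₀|) / lam) S :=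
      (((ContinuousOn.sub (by fun_prop) hFt).abs.add (by fun_prop)).add (by fun_prop)).div_const _
    have hlim := (hbound _ ht₀).tendsto
    simp only [hG p₀ u₀ q₀ t₀ ht₀, hm₀, sub_self, abs_zero, mul_zero, add_zero, zero_div] at hlim
    refine tendsto_iff_dist_tendsto_zero.2 (squeeze_zero' (.of_forall fun _ => dist_nonneg) ?_ hlim)
    filter_upwards [self_mem_nhdsWithin] with z hz
    have h := coercive (G z.1 z.2.1 z.2.2.1 z.2.2.2) z.1 z.2.1 m₀ p₀ u₀ z.2.2.2 hz
    rw [hG _ _ _ _ hz] at h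
    rw [Real.dist_eq, le_div_iff₀' hlam]
    exact h
  · intro m p u q t ht
    refine ⟨fun h => ?_, fun h => h ▸ hG p u q t ht⟩
    have h' := coercive m p u (G p u q t) p u t ht
    rw [h, hG p u q t ht] at h'
    simp only [sub_self, abs_zero, mul_zero, add_zero] at h'
    exact sub_eq_zero.1 (abs_nonpos_iff.1 (nonpos_of_mul_nonpos_right h' hlam))
  · intro p u q p' u' q' t ht
    have h := coercive (G p u q t) p u (G p' u' q' t) p' u' t ht
    rw [hG p u q t ht, hG p' u' q' t ht] at h
    rw [← le_div_iff₀' hlam] at h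
    exact h.trans_eq (by ring)
  · intro p u t ht q q' hq
    by_contra! hlt
    have h := (hF2 (G p u q t) p u (G p u q' t) p u t ht).1
    rw [max_eq_left (by linarith), max_eq_right (by linarith), hG p u q t ht,
      hG p u q' t ht] at h
    simp only [sub_self, abs_zero, mul_zero, sub_zero] at h
    linarith [mul_pos hlam (sub_pos.2 hlt)]
end

section
/- Assume F satisfies (F1) and (F2). Let μ ∈ ℝ and let u ∈ C²(a,b) ∩ C¹([a,b]) be a solution of F(u''(t), u'(t), u(t), t) = −μ·u(t) for all t ∈ (a,b) with u(a) = 0. If u is not identically zero on [a,b], then u'(a) ≠ 0. -/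
open Set

/-- `u ∈ C²(a,b) ∩ C¹([a,b])`, with first derivative `u'` (one-sided at the endpoints)
and second derivative `u''` on the open interval. -/
def C2Fun (a b : ℝ) (u u' u'' : ℝ → ℝ) : Prop :=
  (∀ t ∈ Set.Icc a b, HasDerivWithinAt u (u' t) (Set.Icc a b) t) ∧
  ContinuousOn u' (Set.Icc a b) ∧
  (∀ t ∈ Set.Ioo a b, HasDerivAt u' (u'' t) t) ∧
  ContinuousOn u'' (Set.Ioo a b)

/-- A nonnegative function vanishing at the left endpoint and satisfying `f' ≤ K * f` in the
interior of `[a, b]` vanishes on `[a, b]`. -/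
theorem eq_zero_of_nonneg_of_deriv_le_mul_self {f f' : ℝ → ℝ} {K a b : ℝ}
    (hf : ContinuousOn f (Icc a b)) (hf' : ∀ t ∈ Ioo a b, HasDerivAt f (f' t) t)
    (hnonneg : ∀ t ∈ Icc a b, 0 ≤ f t) (ha : f a = 0)
    (bound : ∀ t ∈ Ioo a b, f' t ≤ K * f t) :
    ∀ t ∈ Icc a b, f t = 0 := by
  intro t ht
  have hderiv : ∀ x ∈ Ioo a b, HasDerivAt (fun x => f x * Real.exp (-K * x))
      (f' x * Real.exp (-K * x) + f x * (Real.exp (-K * x) * (-K * 1))) x := fun x hx =>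
    (hf' x hx).mul (((hasDerivAt_id x).const_mul (-K)).exp)
  have hanti : AntitoneOn (fun x => f x * Real.exp (-K * x)) (Icc a b) := by
    refine antitoneOn_of_deriv_nonpos (convex_Icc a b) (hf.mul (by fun_prop)) ?_ ?_
    · rw [interior_Icc]
      exact fun x hx => (hderiv x hx).differentiableAt.differentiableWithinAt
    · rw [interior_Icc]
      intro x hx
      rw [(hderiv x hx).deriv]
      nlinarith [bound x hx, Real.exp_pos (-K * x)]
  have hle := hanti (left_mem_Icc.2 (ht.1.trans ht.2)) ht ht.1
  simp only [ha, zero_mul] at hle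
  exact le_antisymm (nonpos_of_mul_nonpos_left hle (Real.exp_pos _)) (hnonneg t ht)

/-- A function satisfying `c * |u''| ≤ A * |u'| + B * |u|` with zero Cauchy data at the left
endpoint vanishes. -/
theorem C2Fun.eq_zero_of_abs_le {a b c A B : ℝ} {u u' u'' : ℝ → ℝ} (hu : C2Fun a b u u' u'')
    (hc : 0 < c) (hA : 0 ≤ A) (hB : 0 ≤ B)
    (bound : ∀ t ∈ Ioo a b, c * |u'' t| ≤ A * |u' t| + B * |u t|)
    (hua : u a = 0) (hua' : u' a = 0) :
    ∀ t ∈ Icc a b, u t = 0 := by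
  obtain ⟨hd, hc', hd', -⟩ := hu
  have henergy : ∀ t ∈ Icc a b, u t ^ 2 + u' t ^ 2 = 0 := by
    refine eq_zero_of_nonneg_of_deriv_le_mul_self (f := fun t => u t ^ 2 + u' t ^ 2)
      (f' := fun t => 2 * u t * u' t + 2 * u' t * u'' t) (K := (c + 2 * A + B) / c) ?_ ?_ ?_ ?_ ?_
    · have hcu : ContinuousOn u (Icc a b) := fun t ht => (hd t ht).continuousWithinAt
      exact (hcu.pow 2).add (hc'.pow 2)
    · intro t ht
      have h := (hd t (Ioo_subset_Icc_self ht)).hasDerivAt (Icc_mem_nhds ht.1 ht.2)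
      refine ((h.fun_pow 2).fun_add ((hd' t ht).fun_pow 2)).congr_deriv ?_
      simp
    · intro t _
      positivity
    · simp [hua, hua']
    · intro t ht
      rw [div_mul_eq_mul_div, le_div_iff₀ hc]
      have h₁ : u t * u' t ≤ |u t| * |u' t| := by
        rw [← abs_mul]
        exact le_abs_self _
      have h₂ : u' t * u'' t ≤ |u' t| * |u'' t| := by
        rw [← abs_mul]
        exact le_abs_self _
      have h₃ := mul_le_mul_of_nonneg_left (bound t ht) (abs_nonneg (u' t))
      have h₄ := mul_le_mul_of_nonneg_left h₁ hc.le
      have h₅ := mul_le_mul_of_nonneg_left h₂ hc.le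
      have h₆ := mul_nonneg (add_nonneg hc.le hB) (sq_nonneg (|u t| - |u' t|))
      have h₇ := mul_nonneg hA (sq_nonneg |u t|)
      rw [← sq_abs (u t), ← sq_abs (u' t)]
      linarith
  intro t ht
  nlinarith [henergy t ht, sq_nonneg (u t), sq_nonneg (u' t)]

/-- if `u` is a nontrivial solution of `F(u'',u',u,t) = -μ u` on `(a,b)`
with `u(a) = 0`, then `u'(a) ≠ 0`. -/
theorem stmt_1
    (a b lam Lam gam del : ℝ) (hab : a < b)
    (hlam : 0 < lam) (hLam : lam ≤ Lam) (hgam : 0 < gam) (hdel : 0 < del)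
    (F : ℝ → ℝ → ℝ → ℝ → ℝ)
    (hFcont : ContinuousOn (fun z : ℝ × ℝ × ℝ × ℝ => F z.1 z.2.1 z.2.2.1 z.2.2.2)
      {z : ℝ × ℝ × ℝ × ℝ | z.2.2.2 ∈ Icc a b})
    (hF1 : ∀ s : ℝ, 0 ≤ s → ∀ m p u : ℝ, ∀ t ∈ Icc a b,
      F (s * m) (s * p) (s * u) t = s * F m p u t)
    (hF2 : ∀ m p u m' p' u' : ℝ, ∀ t ∈ Icc a b,
      lam * max (m - m') 0 - Lam * max (-(m - m')) 0 - gam * |p - p'| - del * |u - u'|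
          ≤ F m p u t - F m' p' u' t ∧
        F m p u t - F m' p' u' t
          ≤ Lam * max (m - m') 0 - lam * max (-(m - m')) 0 + gam * |p - p'| + del * |u - u'|)
    (μ : ℝ) (u u' u'' : ℝ → ℝ)
    (hu : C2Fun a b u u' u'')
    (heq : ∀ t ∈ Ioo a b, F (u'' t) (u' t) (u t) t = -μ * u t)
    (hua : u a = 0)
    (hnz : ∃ t ∈ Icc a b, u t ≠ 0) :
    u' a ≠ 0 := by
  intro hua'
  obtain ⟨t, ht, hne⟩ := hnz
  refine hne (hu.eq_zero_of_abs_le hlam hgam.le (add_nonneg hdel.le (abs_nonneg μ)) ?_ hua hua' t ht)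
  intro s hs
  have hsI := Ioo_subset_Icc_self hs
  have hF0 : F 0 0 0 s = 0 := by simpa using hF1 0 le_rfl 0 0 0 s hsI
  have h := hF2 (u'' s) (u' s) (u s) 0 0 0 s hsI
  rw [heq s hs, hF0] at h
  simp only [sub_zero] at h
  obtain ⟨hlow, hupp⟩ := h
  have hμ : |μ * u s| = |μ| * |u s| := abs_mul _ _
  rcases le_total 0 (u'' s) with hm | hm
  · rw [max_eq_left hm, max_eq_right (neg_nonpos.2 hm)] at hlow
    rw [abs_of_nonneg hm]
    linarith [neg_abs_le (μ * u s)]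
  · rw [max_eq_right hm, max_eq_left (neg_nonneg.2 hm)] at hupp
    rw [abs_of_nonpos hm]
    linarith [le_abs_self (μ * u s)]
end

section
/- (Comparison principle.) Assume F satisfies (F2) and (F3), and additionally that for each fixed (m,p,t) the map u ↦ F(m,p,u,t) is decreasing. If u, v ∈ C²(a,b) ∩ C¹([a,b]) satisfy F(u''(t), u'(t), u(t), t) ≥ F(v''(t), v'(t), v(t), t) for all t ∈ (a,b), and u(a) = v(a), u(b) = v(b), then u ≤ v on [a,b]. -/
open Set

/-- At a local maximum the second derivative is nonpositive. -/
theorem deriv_deriv_nonpos_of_isLocalMax {f : ℝ → ℝ} {x : ℝ} (h : IsLocalMax f x)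
    (hc : ContinuousAt f x) : deriv (deriv f) x ≤ 0 := by
  by_contra! hpos
  have hmin := isLocalMin_of_deriv_deriv_pos hpos h.deriv_eq_zero hc
  have heq : f =ᶠ[nhds x] fun _ => f x := by
    filter_upwards [h, hmin] with y h₁ h₂ using le_antisymm h₁ h₂
  have hzero : deriv (deriv f) x = 0 := by
    rw [heq.deriv.deriv_eq]
    simp
  exact hpos.ne' hzero

/-- comparison principle for `F` satisfying (F2), (F3) and decreasing in `u`. -/
theorem stmt_3
    (a b lam Lam gam del : ℝ) (hab : a < b)
    (hlam : 0 < lam) (hLam : lam ≤ Lam) (hgam : 0 < gam) (hdel : 0 < del)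
    (F : ℝ → ℝ → ℝ → ℝ → ℝ)
    (hFcont : ContinuousOn (fun z : ℝ × ℝ × ℝ × ℝ => F z.1 z.2.1 z.2.2.1 z.2.2.2)
      {z : ℝ × ℝ × ℝ × ℝ | z.2.2.2 ∈ Icc a b})
    (hF2 : ∀ m p u m' p' u' : ℝ, ∀ t ∈ Icc a b,
      lam * max (m - m') 0 - Lam * max (-(m - m')) 0 - gam * |p - p'| - del * |u - u'|
          ≤ F m p u t - F m' p' u' t ∧
        F m p u t - F m' p' u' t
          ≤ Lam * max (m - m') 0 - lam * max (-(m - m')) 0 + gam * |p - p'| + del * |u - u'|)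
    (hF3 : ∀ m p u m' p' u' : ℝ, ∀ t ∈ Icc a b,
      -F (m' - m) (p' - p) (u' - u) t ≤ F m p u t - F m' p' u' t ∧
        F m p u t - F m' p' u' t ≤ F (m - m') (p - p') (u - u') t)
    (hdec : ∀ m p : ℝ, ∀ t ∈ Icc a b, StrictAnti fun u => F m p u t)
    (u u' u'' v v' v'' : ℝ → ℝ)
    (hu : C2Fun a b u u' u'') (hv : C2Fun a b v v' v'')
    (hcomp : ∀ t ∈ Ioo a b, F (v'' t) (v' t) (v t) t ≤ F (u'' t) (u' t) (u t) t)
    (ha : u a = v a) (hb : u b = v b) :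
    ∀ t ∈ Icc a b, u t ≤ v t := by
  obtain ⟨hu₁, -, hu₂, -⟩ := hu
  obtain ⟨hv₁, -, hv₂, -⟩ := hv
  have hcont : ContinuousOn (fun t => u t - v t) (Icc a b) := fun t ht =>
    ((hu₁ t ht).sub (hv₁ t ht)).continuousWithinAt
  obtain ⟨c, hc, hmax⟩ := isCompact_Icc.exists_isMaxOn (nonempty_Icc.2 hab.le) hcont
  by_contra! hne
  obtain ⟨s, hs, hlt⟩ := hne
  have hpos : v c < u c := by
    have : u s - v s ≤ u c - v c := hmax hs
    linarith
  have hc' : c ∈ Ioo a b := by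
    refine ⟨lt_of_le_of_ne hc.1 ?_, lt_of_le_of_ne hc.2 ?_⟩
    · rintro rfl
      exact hpos.ne' ha
    · rintro rfl
      exact hpos.ne' hb
  have hderiv : ∀ t ∈ Ioo a b, HasDerivAt (fun t => u t - v t) (u' t - v' t) t := fun t ht =>
    ((hu₁ t (Ioo_subset_Icc_self ht)).hasDerivAt (Icc_mem_nhds ht.1 ht.2)).sub
      ((hv₁ t (Ioo_subset_Icc_self ht)).hasDerivAt (Icc_mem_nhds ht.1 ht.2))
  have hloc : IsLocalMax (fun t => u t - v t) c := hmax.isLocalMax (Icc_mem_nhds hc'.1 hc'.2)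
  have hfirst : u' c = v' c := sub_eq_zero.1 (hloc.hasDerivAt_eq_zero (hderiv c hc'))
  have hsecond : u'' c - v'' c ≤ 0 := by
    have heq : deriv (fun t => u t - v t) =ᶠ[nhds c] fun t => u' t - v' t := by
      filter_upwards [Ioo_mem_nhds hc'.1 hc'.2] with t ht using (hderiv t ht).deriv
    have hval : deriv (deriv fun t => u t - v t) c = u'' c - v'' c := by
      rw [heq.deriv_eq]
      exact ((hu₂ c hc').sub (hv₂ c hc')).deriv
    exact hval ▸ deriv_deriv_nonpos_of_isLocalMax hloc (hderiv c hc').continuousAt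
  have hmono := (hF2 (u'' c) (v' c) (u c) (v'' c) (v' c) (u c) c hc).2
  have hstrict : F (v'' c) (v' c) (u c) c < F (v'' c) (v' c) (v c) c := hdec _ _ c hc hpos
  have hle := hcomp c hc'
  rw [hfirst] at hle
  rw [max_eq_right hsecond, sub_self, sub_self, abs_zero] at hmono
  have := mul_nonneg hlam.le (le_max_right (-(u'' c - v'' c)) 0)
  linarith
end

section
/- Assume F satisfies (F1), (F2) and (F3). Then there exists κ > 0 such that for every continuous f : [a,b] → ℝ the Dirichlet problem F(u''(t), u'(t), u(t), t) − κ·u(t) = f(t) for t ∈ (a,b), with u(a) = u(b) = 0, has a unique solution u ∈ C²(a,b) ∩ C¹([a,b]). -/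
open Set

section InitialValueProblem

open Metric

open scoped NNReal

/-- Truncation of a real number to `[-R, R]`. -/
noncomputable def truncate (R x : ℝ) : ℝ := max (-R) (min R x)

lemma abs_truncate_le {R : ℝ} (hR : 0 ≤ R) (x : ℝ) : |truncate R x| ≤ R :=
  abs_le.2 ⟨le_max_left _ _, max_le (by linarith) (min_le_left _ _)⟩

lemma abs_truncate_le_abs {R : ℝ} (hR : 0 ≤ R) (x : ℝ) : |truncate R x| ≤ |x| := by
  unfold truncate
  rcases max_cases (-R) (min R x) with h | h <;> rcases min_cases R x with h' | h' <;>
    rw [abs_le] <;> constructor <;> cases abs_cases x <;> linarith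

lemma truncate_eq_self {R x : ℝ} (hx : |x| ≤ R) : truncate R x = x := by
  rw [abs_le] at hx
  rw [truncate, min_eq_right hx.2, max_eq_right hx.1]

lemma abs_truncate_sub_truncate_le (R x y : ℝ) : |truncate R x - truncate R y| ≤ |x - y| := by
  unfold truncate
  rw [max_comm (-R), max_comm (-R), min_comm R, min_comm R]
  calc |max (min x R) (-R) - max (min y R) (-R)|
    _ ≤ |min x R - min y R| := abs_max_sub_max_le_abs _ _ _
    _ ≤ max |x - y| |R - R| := abs_min_sub_min_le_max _ _ _ _
    _ = |x - y| := by simp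

/-- Truncation of both coordinates of a point of the plane to `[-R, R]`. -/
noncomputable def truncatePair (R : ℝ) (x : ℝ × ℝ) : ℝ × ℝ := (truncate R x.1, truncate R x.2)

lemma norm_truncatePair_le {R : ℝ} (hR : 0 ≤ R) (x : ℝ × ℝ) : ‖truncatePair R x‖ ≤ R :=
  max_le (abs_truncate_le hR _) (abs_truncate_le hR _)

lemma norm_truncatePair_le_norm {R : ℝ} (hR : 0 ≤ R) (x : ℝ × ℝ) : ‖truncatePair R x‖ ≤ ‖x‖ :=
  max_le_max (abs_truncate_le_abs hR _) (abs_truncate_le_abs hR _)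

lemma truncatePair_eq_self {R : ℝ} {x : ℝ × ℝ} (hx : ‖x‖ ≤ R) : truncatePair R x = x :=
  Prod.ext (truncate_eq_self ((le_max_left _ _).trans hx))
    (truncate_eq_self ((le_max_right _ _).trans hx))

lemma lipschitzWith_truncatePair (R : ℝ) : LipschitzWith 1 (truncatePair R) :=
  LipschitzWith.of_dist_le_mul fun x y => by
    rw [NNReal.coe_one, one_mul]
    exact max_le_max (abs_truncate_sub_truncate_le _ _ _) (abs_truncate_sub_truncate_le _ _ _)

lemma HasDerivWithinAt.Ici_of_Icc {E : Type*} [NormedAddCommGroup E] [NormedSpace ℝ E]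
    {f : ℝ → E} {f' : E} {a b t : ℝ} (h : HasDerivWithinAt f f' (Icc a b) t)
    (ht : t ∈ Ico a b) : HasDerivWithinAt f f' (Ici t) t :=
  h.mono_of_mem_nhdsWithin (Icc_mem_nhdsGE_of_mem ht)

/-- Global solvability of the initial value problem in the plane for a globally Lipschitz field. -/
theorem exists_hasDerivWithinAt_Icc_of_lipschitzWith {a b : ℝ} (hab : a ≤ b) {K : ℝ≥0}
    {v : ℝ → ℝ × ℝ → ℝ × ℝ} (hv : ∀ t ∈ Icc a b, LipschitzWith K (v t))
    (hc : ∀ x, ContinuousOn (fun t => v t x) (Icc a b)) (x₀ : ℝ × ℝ) :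
    ∃ x : ℝ → ℝ × ℝ, x a = x₀ ∧
      ∀ t ∈ Icc a b, HasDerivWithinAt x (v t (x t)) (Icc a b) t := by
  obtain ⟨C, hC⟩ := isCompact_Icc.exists_bound_of_continuousOn (hc 0)
  have hC0 : 0 ≤ C := (norm_nonneg _).trans (hC a (left_mem_Icc.2 hab))
  have growth : ∀ t ∈ Icc a b, ∀ x, ‖v t x‖ ≤ K * ‖x‖ + C := fun t ht x => by
    have h := (hv t ht).norm_sub_le x 0
    rw [sub_zero] at h
    linarith [norm_le_norm_sub_add (v t x) (v t 0), hC t ht]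
  set R : ℝ := gronwallBound ‖x₀‖ K C (b - a)
  have hmono : Monotone (gronwallBound ‖x₀‖ K C) := gronwallBound_mono (norm_nonneg _) hC0 K.2
  have hR : 0 ≤ R := (norm_nonneg x₀).trans <| by
    have := hmono (sub_nonneg.2 hab)
    rwa [gronwallBound_x0] at this
  set L : ℝ≥0 := ⟨K * R + C, by positivity⟩
  set A : ℝ≥0 := L * ⟨b - a, sub_nonneg.2 hab⟩
  have hpl : IsPicardLindelof (fun t x => v t (truncatePair R x))
      (⟨a, left_mem_Icc.2 hab⟩ : Icc a b) x₀ A 0 L K := by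
    refine ⟨fun t ht => ?_, fun x _ => hc _, fun t ht x _ => ?_, ?_⟩
    · have := (hv t ht).comp (lipschitzWith_truncatePair R)
      rw [mul_one] at this
      exact this.lipschitzOnWith
    · refine (growth t ht _).trans ?_
      change _ ≤ K * R + C
      gcongr
      exact norm_truncatePair_le hR x
    · simp only [sub_self, NNReal.coe_zero, sub_zero]
      rw [max_eq_left (sub_nonneg.2 hab)]
      exact le_rfl
  obtain ⟨x, hxa, hx⟩ := hpl.exists_eq_forall_mem_Icc_hasDerivWithinAt₀
  refine ⟨x, hxa, fun t ht => ?_⟩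
  have hbound : ∀ t ∈ Icc a b, ‖x t‖ ≤ gronwallBound ‖x₀‖ K C (t - a) :=
    norm_le_gronwallBound_of_norm_deriv_right_le (fun t ht => (hx t ht).continuousWithinAt)
      (fun t ht => (hx t (Ico_subset_Icc_self ht)).Ici_of_Icc ht) (by rw [← hxa])
      fun t ht => (growth t (Ico_subset_Icc_self ht) _).trans <| by
        gcongr
        exact norm_truncatePair_le_norm hR _
  have h := hx t ht
  rwa [truncatePair_eq_self ((hbound t ht).trans (hmono (by linarith [ht.2])))] at h

end InitialValueProblem

section Shooting

/-- If `w'' ≥ -c |w'|` wherever `w ≥ 0`, then a function starting from `0` with positive slope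
has slope bounded below. -/
theorem slope_lower_bound {a b c σ : ℝ} (hσ : 0 < σ)
    {w w' w'' : ℝ → ℝ} (hw : ∀ t ∈ Icc a b, HasDerivWithinAt w (w' t) (Icc a b) t)
    (hw' : ∀ t ∈ Icc a b, HasDerivWithinAt w' (w'' t) (Icc a b) t)
    (hwa : w a = 0) (hwa' : w' a = σ)
    (hineq : ∀ t ∈ Icc a b, 0 ≤ w t → -(c * |w' t|) ≤ w'' t) :
    ∀ t ∈ Icc a b, σ * Real.exp (-((c + 1) * (t - a))) ≤ w' t := by
  have hcont : ContinuousOn w (Icc a b) := fun t ht => (hw t ht).continuousWithinAt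
  have hcont' : ContinuousOn w' (Icc a b) := fun t ht => (hw' t ht).continuousWithinAt
  have bound_of_nonneg : ∀ d ≤ b, (∀ t ∈ Ico a d, 0 ≤ w t) →
      ∀ t ∈ Icc a d, σ * Real.exp (-((c + 1) * (t - a))) ≤ w' t := by
    intro d hd hpos t ht
    have hB : ∀ t, HasDerivAt (fun t => -(σ * Real.exp (-((c + 1) * (t - a)))))
        ((c + 1) * (σ * Real.exp (-((c + 1) * (t - a))))) t := fun t => by
      have h := ((((hasDerivAt_id t).sub_const a).const_mul (c + 1)).neg.exp.const_mul σ).neg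
      refine h.congr_deriv ?_
      simp only [id, Pi.neg_apply]
      ring
    have key := image_le_of_deriv_right_lt_deriv_boundary' (f := fun t => -w' t)
      (f' := fun t => -w'' t) (a := a) (b := d)
      (hcont'.mono (Icc_subset_Icc_right hd)).neg
      (fun s hs => ((hw' s ⟨hs.1, hs.2.le.trans hd⟩).Ici_of_Icc ⟨hs.1, hs.2.trans_le hd⟩).neg)
      (B := fun t => -(σ * Real.exp (-((c + 1) * (t - a))))) (by simp [hwa'])
      (fun s _ => (hB s).continuousAt.continuousWithinAt)
      (fun s _ => (hB s).hasDerivWithinAt)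
      (fun s hs hsB => by
        have hE : 0 < σ * Real.exp (-((c + 1) * (s - a))) := by positivity
        have hsB' : w' s = σ * Real.exp (-((c + 1) * (s - a))) := neg_injective hsB
        have h := hineq s ⟨hs.1, hs.2.le.trans hd⟩ (hpos s hs)
        rw [← hsB'] at hE ⊢
        rw [abs_of_pos hE] at h
        linarith)
      ht
    exact neg_le_neg_iff.1 key
  have nonneg_of_slope : ∀ d ≤ b, (∀ t ∈ Ico a d, 0 ≤ w' t) → ∀ t ∈ Icc a d, 0 ≤ w t := by
    intro d hd hpos t ht
    have key := image_le_of_deriv_right_le_deriv_boundary (f := fun _ => (0 : ℝ))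
      (f' := fun _ => 0) (B := w) (B' := w') (a := a) (b := d) continuousOn_const
      (fun s _ => hasDerivWithinAt_const _ _ _) hwa.ge
      (hcont.mono (Icc_subset_Icc_right hd))
      (fun s hs => (hw s ⟨hs.1, hs.2.le.trans hd⟩).Ici_of_Icc ⟨hs.1, hs.2.trans_le hd⟩) hpos
    exact key ht
  have slope_pos : ∀ t ∈ Icc a b, 0 < w' t := by
    by_contra! hne
    have hcomp : IsCompact (Icc a b ∩ w' ⁻¹' Iic 0) :=
      isCompact_Icc.of_isClosed_subset (hcont'.preimage_isClosed_of_isClosed isClosed_Icc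
        isClosed_Iic) inter_subset_left
    obtain ⟨d, ⟨hd, hd0⟩, hleast⟩ := hcomp.exists_isLeast hne
    have hbefore : ∀ t ∈ Ico a d, 0 ≤ w' t := fun t ht => by
      by_contra! hlt
      exact (hleast ⟨⟨ht.1, ht.2.le.trans hd.2⟩, hlt.le⟩).not_gt ht.2
    have h := bound_of_nonneg d hd.2 (fun t ht => nonneg_of_slope d hd.2 hbefore t
      (Ico_subset_Icc_self ht)) d (right_mem_Icc.2 hd.1)
    have hE : 0 < σ * Real.exp (-((c + 1) * (d - a))) := by positivity
    have hd0' : w' d ≤ 0 := hd0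
    linarith
  exact bound_of_nonneg b le_rfl fun t ht => nonneg_of_slope b le_rfl
    (fun s hs => (slope_pos s (Ico_subset_Icc_self hs)).le) t (Ico_subset_Icc_self ht)

/-- Solvability by shooting of the Dirichlet problem for `u'' = g(t, (u, u'))`. -/
theorem exists_dirichlet_solution {a b c : ℝ} (hab : a < b) (hc : 0 ≤ c) {K : NNReal}
    {g : ℝ → ℝ × ℝ → ℝ} (hg : ∀ t ∈ Icc a b, LipschitzWith K (g t))
    (hgc : ∀ x, ContinuousOn (fun t => g t x) (Icc a b))
    (hmono : ∀ t ∈ Icc a b, ∀ u p v q : ℝ, v ≤ u → -(c * |p - q|) ≤ g t (u, p) - g t (v, q)) :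
    ∃ u u' : ℝ → ℝ, u a = 0 ∧ u b = 0 ∧
      (∀ t ∈ Icc a b, HasDerivWithinAt u (u' t) (Icc a b) t) ∧
      ∀ t ∈ Icc a b, HasDerivWithinAt u' (g t (u t, u' t)) (Icc a b) t := by
  have hv : ∀ t ∈ Icc a b, LipschitzWith (max 1 K) (fun x : ℝ × ℝ => (x.2, g t x)) :=
    fun t ht => LipschitzWith.prod_snd.prodMk (hg t ht)
  have hvc : ∀ x : ℝ × ℝ, ContinuousOn (fun t => (x.2, g t x)) (Icc a b) := fun x =>
    continuousOn_const.prodMk (hgc x)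
  choose x hxa hx using fun s : ℝ =>
    exists_hasDerivWithinAt_Icc_of_lipschitzWith hab.le hv hvc (0, s)
  have hx1 : ∀ s, ∀ t ∈ Icc a b,
      HasDerivWithinAt (fun t => (x s t).1) (x s t).2 (Icc a b) t := fun s t ht =>
    (hx s t ht).fst
  have hx2 : ∀ s, ∀ t ∈ Icc a b,
      HasDerivWithinAt (fun t => (x s t).2) (g t (x s t)) (Icc a b) t := fun s t ht =>
    (hx s t ht).snd
  have hcontx : ∀ s, ContinuousOn (x s) (Icc a b) := fun s t ht => (hx s t ht).continuousWithinAt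
  have hb : b ∈ Icc a b := right_mem_Icc.2 hab.le
  have hφ : Continuous fun s => (x s b).1 := by
    refine (LipschitzWith.of_dist_le_mul
      (K := (Real.exp ((max 1 K : NNReal) * (b - a))).toNNReal) fun s r => ?_).continuous
    have h := dist_le_of_trajectories_ODE_of_mem (v := fun t (x : ℝ × ℝ) => (x.2, g t x))
      (K := max 1 K) (s := fun _ => univ) (a := a) (b := b)
      (fun t ht => (hv t (Ico_subset_Icc_self ht)).lipschitzOnWith)
      (hcontx s) (fun t ht => (hx s t (Ico_subset_Icc_self ht)).Ici_of_Icc ht)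
      (fun _ _ => mem_univ _)
      (hcontx r) (fun t ht => (hx r t (Ico_subset_Icc_self ht)).Ici_of_Icc ht)
      (fun _ _ => mem_univ _) (δ := dist s r) (by simp [hxa, Prod.dist_eq]) b hb
    rw [Real.coe_toNNReal _ (Real.exp_pos _).le, mul_comm]
    exact (le_max_left _ _).trans h
  set η : ℝ := Real.exp (-((c + 1) * (b - a))) * (b - a)
  have hη : 0 < η := mul_pos (Real.exp_pos _) (sub_pos.2 hab)
  have hincr : ∀ r s, r < s → (s - r) * η ≤ (x s b).1 - (x r b).1 := by
    intro r s hrs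
    have hslope := slope_lower_bound (sub_pos.2 hrs)
      (w := fun t => (x s t).1 - (x r t).1) (fun t ht => (hx1 s t ht).sub (hx1 r t ht))
      (fun t ht => (hx2 s t ht).sub (hx2 r t ht)) (by simp [hxa]) (by simp [hxa])
      (fun t ht hpos => hmono t ht _ _ _ _ (sub_nonneg.1 hpos))
    have hline : ∀ t, HasDerivAt
        (fun t => (s - r) * Real.exp (-((c + 1) * (b - a))) * (t - a))
        ((s - r) * Real.exp (-((c + 1) * (b - a)))) t := fun t => by
      simpa using ((hasDerivAt_id t).sub_const a).const_mul
        ((s - r) * Real.exp (-((c + 1) * (b - a))))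
    have key := image_le_of_deriv_right_le_deriv_boundary
      (fun t _ => (hline t).continuousAt.continuousWithinAt)
      (fun t _ => (hline t).hasDerivWithinAt)
      (B := fun t => (x s t).1 - (x r t).1) (a := a) (b := b) (by simp [hxa])
      ((continuous_fst.comp_continuousOn (hcontx s)).sub
        (continuous_fst.comp_continuousOn (hcontx r)))
      (fun t ht => ((hx1 s t (Ico_subset_Icc_self ht)).sub
        (hx1 r t (Ico_subset_Icc_self ht))).Ici_of_Icc ht)
      (fun t ht => (hslope t (Ico_subset_Icc_self ht)).trans' <| by
        have : 0 < s - r := sub_pos.2 hrs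
        gcongr
        exact ht.2.le) hb
    simpa only [η, mul_assoc] using key
  obtain ⟨s, hs⟩ : ∃ s, (x s b).1 = 0 := by
    set M := |(x 0 b).1| / η + 1
    have hM : 0 < M := by positivity
    have hMη : |(x 0 b).1| ≤ M * η := by
      have : M * η = |(x 0 b).1| + η := by simp only [M]; field_simp
      linarith
    have hpos : 0 ≤ (x M b).1 := by
      have h := hincr 0 M hM
      linarith [neg_abs_le (x 0 b).1]
    have hneg : (x (-M) b).1 ≤ 0 := by
      have h := hincr (-M) 0 (by linarith)
      linarith [le_abs_self (x 0 b).1]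
    obtain ⟨s, -, hs⟩ := intermediate_value_Icc (by linarith : -M ≤ M) hφ.continuousOn
      ⟨hneg, hpos⟩
    exact ⟨s, hs⟩
  exact ⟨fun t => (x s t).1, fun t => (x s t).2, by simp [hxa], hs, hx1 s, hx2 s⟩

end Shooting

section MaximumPrinciple

/-- A function with nonpositive boundary values which is strictly convex at all its positive
critical points is nonpositive. -/
theorem nonpos_of_deriv_deriv_pos {a b : ℝ} {w w' w'' : ℝ → ℝ}
    (hcont : ContinuousOn w (Icc a b)) (hw : ∀ t ∈ Ioo a b, HasDerivAt w (w' t) t)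
    (hw' : ∀ t ∈ Ioo a b, HasDerivAt w' (w'' t) t) (hwa : w a ≤ 0) (hwb : w b ≤ 0)
    (hpos : ∀ t ∈ Ioo a b, 0 < w t → w' t = 0 → 0 < w'' t) :
    ∀ t ∈ Icc a b, w t ≤ 0 := by
  intro s hs
  obtain ⟨t, ht, hmax⟩ := isCompact_Icc.exists_isMaxOn ⟨s, hs⟩ hcont
  refine (hmax hs).trans ?_
  by_contra! hlt
  have hta : a < t := ht.1.lt_of_ne (by rintro rfl; linarith)
  have htb : t < b := ht.2.lt_of_ne (by rintro rfl; linarith)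
  have ht' : t ∈ Ioo a b := ⟨hta, htb⟩
  have hlmax : IsLocalMax w t := hmax.isLocalMax (Icc_mem_nhds hta htb)
  have hcrit : w' t = 0 := hlmax.hasDerivAt_eq_zero (hw t ht')
  have hderiv : deriv w =ᶠ[nhds t] w' := by
    filter_upwards [Ioo_mem_nhds hta htb] with r hr using (hw r hr).deriv
  have hdd : deriv (deriv w) t = w'' t := by rw [hderiv.deriv_eq, (hw' t ht').deriv]
  have hpp := hpos t ht' hlt hcrit
  have hlmin : IsLocalMin w t := isLocalMin_of_deriv_deriv_pos (by rwa [hdd])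
    (by rw [hderiv.eq_of_nhds, hcrit]) (hw t ht').continuousAt
  have hconst : w =ᶠ[nhds t] fun _ => w t := by
    filter_upwards [hlmax, hlmin] with r h₁ h₂ using le_antisymm h₁ h₂
  have hzero : deriv (deriv w) t = 0 := by
    rw [hconst.deriv.deriv_eq]
    simp
  linarith

end MaximumPrinciple

/-- there is `κ > 0` such that the Dirichlet problem
`F(u'',u',u,t) - κ u = f` in `(a,b)`, `u(a) = u(b) = 0`, is uniquely solvable for every
continuous right-hand side `f`. -/
theorem stmt_4
    (a b lam Lam gam del : ℝ) (hab : a < b)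
    (hlam : 0 < lam) (hLam : lam ≤ Lam) (hgam : 0 < gam) (hdel : 0 < del)
    (F : ℝ → ℝ → ℝ → ℝ → ℝ)
    (hFcont : ContinuousOn (fun z : ℝ × ℝ × ℝ × ℝ => F z.1 z.2.1 z.2.2.1 z.2.2.2)
      {z : ℝ × ℝ × ℝ × ℝ | z.2.2.2 ∈ Icc a b})
    (hF1 : ∀ s : ℝ, 0 ≤ s → ∀ m p u : ℝ, ∀ t ∈ Icc a b,
      F (s * m) (s * p) (s * u) t = s * F m p u t)
    (hF2 : ∀ m p u m' p' u' : ℝ, ∀ t ∈ Icc a b,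
      lam * max (m - m') 0 - Lam * max (-(m - m')) 0 - gam * |p - p'| - del * |u - u'|
          ≤ F m p u t - F m' p' u' t ∧
        F m p u t - F m' p' u' t
          ≤ Lam * max (m - m') 0 - lam * max (-(m - m')) 0 + gam * |p - p'| + del * |u - u'|)
    (hF3 : ∀ m p u m' p' u' : ℝ, ∀ t ∈ Icc a b,
      -F (m' - m) (p' - p) (u' - u) t ≤ F m p u t - F m' p' u' t ∧
        F m p u t - F m' p' u' t ≤ F (m - m') (p - p') (u - u') t) :
    ∃ κ : ℝ, 0 < κ ∧
      ∀ f : ℝ → ℝ, ContinuousOn f (Icc a b) →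
        ∃ u u' u'' : ℝ → ℝ,
          (C2Fun a b u u' u'' ∧
            (∀ t ∈ Ioo a b, F (u'' t) (u' t) (u t) t - κ * u t = f t) ∧
            u a = 0 ∧ u b = 0) ∧
          ∀ v v' v'' : ℝ → ℝ,
            C2Fun a b v v' v'' →
            (∀ t ∈ Ioo a b, F (v'' t) (v' t) (v t) t - κ * v t = f t) →
            v a = 0 → v b = 0 →
            ∀ t ∈ Icc a b, v t = u t := by
  refine ⟨del + 1, by linarith, fun f hf => ?_⟩
  have hF_time : ∀ m p u, ContinuousOn (fun t => F m p u t) (Icc a b) := fun m p u =>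
    hFcont.comp (f := fun t : ℝ => ((m, p, u, t) : ℝ × ℝ × ℝ × ℝ)) (by fun_prop) fun t ht => ht
  have hF_m : ∀ p u, ∀ t ∈ Icc a b, Continuous fun m => F m p u t := fun p u t ht =>
    continuousOn_univ.1 <| hFcont.comp (f := fun m : ℝ => ((m, p, u, t) : ℝ × ℝ × ℝ × ℝ))
      (by fun_prop) fun m _ => ht
  have hF_incr : ∀ p u, ∀ t ∈ Icc a b, ∀ m m', m' ≤ m →
      lam * (m - m') ≤ F m p u t - F m' p u t := fun p u t ht m m' hm => by
    have h := (hF2 m p u m' p u t ht).1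
    rw [max_eq_left (by linarith : 0 ≤ m - m'), max_eq_right (by linarith : -(m - m') ≤ 0)] at h
    simpa using h
  have hF_expand : ∀ p u, ∀ t ∈ Icc a b, ∀ m m',
      lam * |m - m'| ≤ |F m p u t - F m' p u t| := fun p u t ht m m' => by
    rcases le_total m' m with h | h
    · rw [abs_of_nonneg (sub_nonneg.2 h)]
      exact (hF_incr p u t ht m m' h).trans (le_abs_self _)
    · rw [abs_sub_comm, abs_of_nonneg (sub_nonneg.2 h), abs_sub_comm]
      exact (hF_incr p u t ht m' m h).trans (le_abs_self _)
  have hF_surj : ∀ t ∈ Icc a b, ∀ p u y, ∃ m, F m p u t = y := by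
    intro t ht p u y
    set M := |y - F 0 p u t| / lam
    have hM : 0 ≤ M := by positivity
    have hMlam : lam * M = |y - F 0 p u t| := by simp only [M]; field_simp
    have hup := hF_incr p u t ht M 0 hM
    have hdown := hF_incr p u t ht 0 (-M) (by linarith)
    obtain ⟨m, -, hm⟩ := intermediate_value_Icc (by linarith : -M ≤ M)
      (hF_m p u t ht).continuousOn (show y ∈ Icc _ _ from
        ⟨by linarith [neg_abs_le (y - F 0 p u t)], by linarith [le_abs_self (y - F 0 p u t)]⟩)
    exact ⟨m, hm⟩
  have hex : ∀ t : ℝ, ∀ x : ℝ × ℝ, ∃ m, t ∈ Icc a b →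
      F m x.2 x.1 t - (del + 1) * x.1 = f t := fun t x => by
    by_cases ht : t ∈ Icc a b
    · obtain ⟨m, hm⟩ := hF_surj t ht x.2 x.1 (f t + (del + 1) * x.1)
      exact ⟨m, fun _ => by linarith⟩
    · exact ⟨0, fun h => absurd h ht⟩
  choose g hg using hex
  have hg_mono : ∀ t ∈ Icc a b, ∀ u p v q : ℝ, v ≤ u →
      -(gam / lam * |p - q|) ≤ g t (u, p) - g t (v, q) := fun t ht u p v q huv => by
    have hx := hg t (u, p) ht
    have hy := hg t (v, q) ht
    have h := (hF2 (g t (u, p)) p u (g t (v, q)) q v t ht).2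
    rw [abs_of_nonneg (sub_nonneg.2 huv)] at h
    set d := g t (u, p) - g t (v, q)
    rcases le_total 0 d with hd | hd
    · have : 0 ≤ gam / lam * |p - q| := by positivity
      linarith
    · rw [max_eq_right hd, max_eq_left (neg_nonneg.2 hd)] at h
      rw [neg_le, div_mul_eq_mul_div, le_div_iff₀ hlam]
      linarith
  have hg_lip : ∀ t ∈ Icc a b,
      LipschitzWith ((gam + 2 * del + 1) / lam).toNNReal (g t) := fun t ht =>
    LipschitzWith.of_dist_le_mul fun x y => by
      rw [Real.coe_toNNReal _ (by positivity), Real.dist_eq, div_mul_eq_mul_div,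
        le_div_iff₀ hlam]
      have h₁ : |x.1 - y.1| ≤ dist x y := le_max_left _ _
      have h₂ : |x.2 - y.2| ≤ dist x y := le_max_right _ _
      have hx := hg t x ht
      have hy := hg t y ht
      obtain ⟨hl, hu⟩ := hF2 (g t x) x.2 x.1 (g t y) y.2 y.1 t ht
      have hκ₁ := mul_le_mul_of_nonneg_left (le_abs_self (x.1 - y.1))
        (by linarith : 0 ≤ del + 1)
      have hκ₂ := mul_le_mul_of_nonneg_left (neg_abs_le (x.1 - y.1))
        (by linarith : 0 ≤ del + 1)
      have hγ := mul_le_mul_of_nonneg_left h₂ hgam.le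
      have hδ := mul_le_mul_of_nonneg_left h₁ (by linarith : 0 ≤ 2 * del + 1)
      rcases le_total 0 (g t x - g t y) with hd | hd
      · rw [max_eq_left hd, max_eq_right (neg_nonpos.2 hd)] at hl
        rw [abs_of_nonneg hd]
        linarith
      · rw [max_eq_right hd, max_eq_left (neg_nonneg.2 hd)] at hu
        rw [abs_of_nonpos hd]
        linarith
  have hg_cont : ∀ x, ContinuousOn (fun t => g t x) (Icc a b) := by
    intro x t₀ ht₀
    have hh : ContinuousOn (fun t => |f t + (del + 1) * x.1 - F (g t₀ x) x.2 x.1 t| / lam)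
        (Icc a b) := (((hf.add continuousOn_const).sub (hF_time _ _ _)).abs).div_const _
    have hh₀ := hh t₀ ht₀
    have hzero : f t₀ + (del + 1) * x.1 - F (g t₀ x) x.2 x.1 t₀ = 0 := by
      linarith [hg t₀ x ht₀]
    rw [ContinuousWithinAt, hzero, abs_zero, zero_div] at hh₀
    refine tendsto_iff_dist_tendsto_zero.2
      (squeeze_zero' (Filter.Eventually.of_forall fun _ => dist_nonneg) ?_ hh₀)
    filter_upwards [self_mem_nhdsWithin] with t ht
    rw [Real.dist_eq, le_div_iff₀ hlam, mul_comm]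
    have h := hF_expand x.2 x.1 t ht (g t x) (g t₀ x)
    rwa [show F (g t x) x.2 x.1 t = f t + (del + 1) * x.1 by linarith [hg t x ht]] at h
  have hcomparison : ∀ u u' u'' v v' v'' : ℝ → ℝ, C2Fun a b u u' u'' → C2Fun a b v v' v'' →
      (∀ t ∈ Ioo a b, F (u'' t) (u' t) (u t) t - (del + 1) * u t = f t) →
      (∀ t ∈ Ioo a b, F (v'' t) (v' t) (v t) t - (del + 1) * v t = f t) →
      u a = 0 → u b = 0 → v a = 0 → v b = 0 → ∀ t ∈ Icc a b, u t ≤ v t := by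
    intro u u' u'' v v' v'' hu hv hue hve hua hub hva hvb t ht
    refine sub_nonpos.1 (nonpos_of_deriv_deriv_pos (w := fun t => u t - v t)
      (w' := fun t => u' t - v' t) (w'' := fun t => u'' t - v'' t)
      (fun t ht => ((hu.1 t ht).sub (hv.1 t ht)).continuousWithinAt)
      (fun t ht => ((hu.1 t (Ioo_subset_Icc_self ht)).sub
        (hv.1 t (Ioo_subset_Icc_self ht))).hasDerivAt (Icc_mem_nhds ht.1 ht.2))
      (fun t ht => (hu.2.2.1 t ht).sub (hv.2.2.1 t ht)) (by simp [hua, hva])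
      (by simp [hub, hvb]) (fun t ht hpos hcrit => ?_) t ht)
    have h := (hF2 (u'' t) (u' t) (u t) (v'' t) (v' t) (v t) t (Ioo_subset_Icc_self ht)).2
    rw [hcrit, abs_zero, abs_of_pos hpos] at h
    by_contra! hle
    rw [max_eq_right hle, max_eq_left (neg_nonneg.2 hle)] at h
    have := mul_nonneg hlam.le (neg_nonneg.2 hle)
    linarith [hue t ht, hve t ht]
  obtain ⟨u, u', hua, hub, hu, hu'⟩ :=
    exists_dirichlet_solution hab (div_nonneg hgam.le hlam.le) hg_lip hg_cont hg_mono
  have hucont : ContinuousOn u (Icc a b) := fun t ht => (hu t ht).continuousWithinAt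
  have hucont' : ContinuousOn u' (Icc a b) := fun t ht => (hu' t ht).continuousWithinAt
  have hu''cont : ContinuousOn (fun t => g t (u t, u' t)) (Icc a b) :=
    (continuousOn_prod_of_continuousOn_lipschitzOnWith' (fun z : ℝ × ℝ × ℝ => g z.1 z.2)
      (s := Icc a b) (t := univ) _ (fun t ht => (hg_lip t ht).lipschitzOnWith)
      fun x _ => hg_cont x).comp (continuousOn_id.prodMk (hucont.prodMk hucont'))
      fun t ht => ⟨ht, mem_univ _⟩
  have hC2 : C2Fun a b u u' fun t => g t (u t, u' t) :=
    ⟨hu, hucont', fun t ht => (hu' t (Ioo_subset_Icc_self ht)).hasDerivAt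
      (Icc_mem_nhds ht.1 ht.2), hu''cont.mono Ioo_subset_Icc_self⟩
  have hueq : ∀ t ∈ Ioo a b, F (g t (u t, u' t)) (u' t) (u t) t - (del + 1) * u t = f t :=
    fun t ht => hg t (u t, u' t) (Ioo_subset_Icc_self ht)
  refine ⟨u, u', _, ⟨hC2, hueq, hua, hub⟩, fun v v' v'' hv hve hva hvb t ht => ?_⟩
  exact le_antisymm (hcomparison _ _ _ _ _ _ hv hC2 hve hueq hva hvb hua hub t ht)
    (hcomparison _ _ _ _ _ _ hC2 hv hueq hve hua hub hva hvb t ht)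
end

section
/- Assume F satisfies (F1), (F2) and (F3). Then the eigenvalue problem F(u''(t), u'(t), u(t), t) = −μ·u(t) in (a,b), u(a) = u(b) = 0, has a solution pair (λ⁺, u⁺) with u⁺ ∈ C²(a,b) ∩ C¹([a,b]) and u⁺ > 0 on (a,b), and a solution pair (λ⁻, u⁻) with u⁻ < 0 on (a,b). Moreover, if (μ, v) is any solution pair with v ∈ C²(a,b) ∩ C¹([a,b]), v > 0 on (a,b) (resp. v < 0 on (a,b)) and v(a) = v(b) = 0, then μ = λ⁺ (resp. μ = λ⁻) and v is a positive scalar multiple of u⁺ (resp. of u⁻). -/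
open Set

/-- `(μ,u)` is an eigenpair for `F` on `(c,d)` with zero Dirichlet data. -/
def IsEigenpair (F : ℝ → ℝ → ℝ → ℝ → ℝ) (c d μ : ℝ) (u u' u'' : ℝ → ℝ) : Prop :=
  C2Fun c d u u' u'' ∧
  (∀ t ∈ Set.Ioo c d, F (u'' t) (u' t) (u t) t = -μ * u t) ∧
  u c = 0 ∧ u d = 0

section Comparison

variable {W W' : ℝ → ℝ} {s e K : ℝ}

/-- A function with `W' ≥ -K |W|` which starts nonnegative stays nonnegative. -/
theorem nonneg_of_deriv_ge_neg_mul_abs (hc : ContinuousOn W (Icc s e))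
    (hd : ∀ t ∈ Ioo s e, HasDerivAt W (W' t) t) (h0 : 0 ≤ W s)
    (hW : ∀ t ∈ Ioo s e, -K * |W t| ≤ W' t) : ∀ t ∈ Icc s e, 0 ≤ W t := by
  intro t₁ ht₁
  by_contra! hneg
  have hcont₁ : ContinuousOn W (Icc s t₁) := hc.mono (Icc_subset_Icc_right ht₁.2)
  have hcomp : IsCompact (Icc s t₁ ∩ W ⁻¹' Ici 0) :=
    isCompact_Icc.of_isClosed_subset
      (hcont₁.preimage_isClosed_of_isClosed isClosed_Icc isClosed_Ici) inter_subset_left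
  obtain ⟨t₀, ⟨ht₀, hW₀⟩, hgreat⟩ := hcomp.exists_isGreatest ⟨s, left_mem_Icc.2 ht₁.1, h0⟩
  have hW₀' : 0 ≤ W t₀ := hW₀
  have hlt : ∀ t ∈ Ioo t₀ t₁, W t < 0 := by
    intro t ht
    by_contra! h
    exact absurd (hgreat ⟨⟨ht₀.1.trans ht.1.le, ht.2.le⟩, h⟩) (not_le.2 ht.1)
  have hmem : ∀ t ∈ Ioo t₀ t₁, t ∈ Ioo s e := fun t ht =>
    ⟨ht₀.1.trans_lt ht.1, ht.2.trans_le ht₁.2⟩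
  have hmono : MonotoneOn (fun t => W t * Real.exp (-K * t)) (Icc t₀ t₁) := by
    refine monotoneOn_of_hasDerivWithinAt_nonneg
      (f' := fun t => W' t * Real.exp (-K * t) + W t * (Real.exp (-K * t) * -K))
      (convex_Icc _ _) ?_ ?_ ?_
    · exact (hcont₁.mono (Icc_subset_Icc_left ht₀.1)).mul (by fun_prop)
    · intro t ht
      rw [interior_Icc] at ht ⊢
      have he : HasDerivAt (fun t => Real.exp (-K * t)) (Real.exp (-K * t) * -K) t := by
        simpa using ((hasDerivAt_id t).const_mul (-K)).exp
      exact ((hd t (hmem t ht)).mul he).hasDerivWithinAt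
    · intro t ht
      rw [interior_Icc] at ht
      have h1 := hW t (hmem t ht)
      rw [abs_of_neg (hlt t ht)] at h1
      have := mul_nonneg (sub_nonneg.2 h1) (Real.exp_pos (-K * t)).le
      linarith
  have := hmono (left_mem_Icc.2 ht₀.2) (right_mem_Icc.2 ht₀.2) ht₀.2
  have h1 := mul_nonneg hW₀' (Real.exp_pos (-K * t₀)).le
  have h2 := mul_neg_of_neg_of_pos hneg (Real.exp_pos (-K * t₁))
  simp only at this
  linarith

theorem hasDerivAt_mul_exp {t : ℝ} (h : HasDerivAt W (W' t) t) :
    HasDerivAt (fun t => W t * Real.exp (K * t)) ((W' t + K * W t) * Real.exp (K * t)) t := by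
  have he : HasDerivAt (fun t => Real.exp (K * t)) (Real.exp (K * t) * K) t := by
    simpa using ((hasDerivAt_id t).const_mul K).exp
  exact (h.mul he).congr_deriv (by ring)

theorem pos_of_deriv_gt_neg_mul_abs (hc : ContinuousOn W (Icc s e))
    (hd : ∀ t ∈ Ioo s e, HasDerivAt W (W' t) t) (h0 : 0 ≤ W s)
    (hW : ∀ t ∈ Ioo s e, -K * |W t| < W' t) : ∀ t ∈ Ioc s e, 0 < W t := by
  intro t ht
  have hnn := nonneg_of_deriv_ge_neg_mul_abs hc hd h0 fun t ht => (hW t ht).le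
  have hmono : StrictMonoOn (fun t => W t * Real.exp (K * t)) (Icc s e) := by
    refine strictMonoOn_of_hasDerivWithinAt_pos (convex_Icc _ _) (hc.mul (by fun_prop))
      (f' := fun t => (W' t + K * W t) * Real.exp (K * t)) ?_ ?_
    · intro t ht
      rw [interior_Icc] at ht ⊢
      exact (hasDerivAt_mul_exp (hd t ht)).hasDerivWithinAt
    · intro t ht
      rw [interior_Icc] at ht
      have h1 := hW t ht
      rw [abs_of_nonneg (hnn t (Ioo_subset_Icc_self ht))] at h1
      exact mul_pos (by linarith) (Real.exp_pos _)
  have h1 := hmono (left_mem_Icc.2 (ht.1.le.trans ht.2)) (Ioc_subset_Icc_self ht) ht.1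
  have h2 := mul_nonneg h0 (Real.exp_pos (K * s)).le
  exact pos_of_mul_pos_left (h2.trans_lt h1) (Real.exp_pos _).le

theorem eq_zero_of_deriv_ge_neg_mul_abs (hc : ContinuousOn W (Icc s e))
    (hd : ∀ t ∈ Ioo s e, HasDerivAt W (W' t) t) (h0 : W s = 0) (h1 : W e = 0)
    (hW : ∀ t ∈ Ioo s e, -K * |W t| ≤ W' t) : ∀ t ∈ Icc s e, W t = 0 := by
  intro t ht
  have hnn := nonneg_of_deriv_ge_neg_mul_abs hc hd h0.ge hW
  have hmono : MonotoneOn (fun t => W t * Real.exp (K * t)) (Icc s e) := by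
    refine monotoneOn_of_hasDerivWithinAt_nonneg (convex_Icc _ _) (hc.mul (by fun_prop))
      (f' := fun t => (W' t + K * W t) * Real.exp (K * t)) ?_ ?_
    · intro t ht
      rw [interior_Icc] at ht ⊢
      exact (hasDerivAt_mul_exp (hd t ht)).hasDerivWithinAt
    · intro t ht
      rw [interior_Icc] at ht
      have h1 := hW t ht
      rw [abs_of_nonneg (hnn t (Ioo_subset_Icc_self ht))] at h1
      exact mul_nonneg (by linarith) (Real.exp_pos _).le
  have h2 := hmono ht (right_mem_Icc.2 (ht.1.trans ht.2)) ht.2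
  simp only [h1, zero_mul] at h2
  exact le_antisymm (nonpos_of_mul_nonpos_left h2 (Real.exp_pos _)) (hnn t ht)

end Comparison

/-- Positively homogeneous, uniformly elliptic operators, continuous in time. -/
structure EllipticHom (F : ℝ → ℝ → ℝ → ℝ → ℝ) (lam Lam gam del : ℝ) : Prop where
  lam_pos : 0 < lam
  lam_le : lam ≤ Lam
  gam_pos : 0 < gam
  del_pos : 0 < del
  cont : ∀ m p u, Continuous (F m p u)
  upper : ∀ m p u m' p' u' t, F m p u t - F m' p' u' t
    ≤ Lam * max (m - m') 0 - lam * max (-(m - m')) 0 + gam * |p - p'| + del * |u - u'|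
  hom : ∀ s : ℝ, 0 ≤ s → ∀ m p u t, F (s * m) (s * p) (s * u) t = s * F m p u t

/-- The value `m` of the second derivative solving `F m p u t = c`. -/
noncomputable def solveSecond (F : ℝ → ℝ → ℝ → ℝ → ℝ) (p u t c : ℝ) : ℝ :=
  Function.invFun (fun m => F m p u t) c

/-- The vector field of the Prüfer angle `θ` of solutions of `F u'' u' u t = -μ u`,
where `u = r sin θ` and `u' = r cos θ`. -/
noncomputable def angleField (F : ℝ → ℝ → ℝ → ℝ → ℝ) (μ θ t : ℝ) : ℝ :=
  Real.cos θ ^ 2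
    - Real.sin θ * solveSecond F (Real.cos θ) (Real.sin θ) t (-μ * Real.sin θ)

namespace EllipticHom

variable {F : ℝ → ℝ → ℝ → ℝ → ℝ} {lam Lam gam del : ℝ}

theorem neg (h : EllipticHom F lam Lam gam del) :
    EllipticHom (fun m p u t => -F (-m) (-p) (-u) t) lam Lam gam del where
  lam_pos := h.lam_pos
  lam_le := h.lam_le
  gam_pos := h.gam_pos
  del_pos := h.del_pos
  cont m p u := (h.cont _ _ _).neg
  hom s hs m p u t := by
    have := h.hom s hs (-m) (-p) (-u) t
    simp only [mul_neg] at this ⊢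
    rw [this]
  upper m p u m' p' u' t := by
    have := h.upper (-m') (-p') (-u') (-m) (-p) (-u) t
    simp only [neg_sub_neg] at this
    linarith

theorem zero (h : EllipticHom F lam Lam gam del) (t : ℝ) : F 0 0 0 t = 0 := by
  simpa using h.hom 0 le_rfl 0 0 0 t

theorem mul_abs_sub_le (h : EllipticHom F lam Lam gam del) (m p u m' p' u' t : ℝ) :
    lam * |m - m'| ≤ |F m p u t - F m' p' u' t| + gam * |p - p'| + del * |u - u'| := by
  have h1 := h.upper m p u m' p' u' t
  have h2 := h.upper m' p' u' m p u t
  rw [abs_sub_comm p' p, abs_sub_comm u' u] at h2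
  have h3 := neg_abs_le (F m p u t - F m' p' u' t)
  have h4 := le_abs_self (F m p u t - F m' p' u' t)
  rcases le_total m m' with hm | hm
  · rw [abs_of_nonpos (by linarith)]
    rw [max_eq_right (by linarith), max_eq_left (by linarith)] at h1
    linarith
  · rw [abs_of_nonneg (by linarith)]
    rw [max_eq_right (by linarith), max_eq_left (by linarith)] at h2
    linarith

theorem continuous_second (h : EllipticHom F lam Lam gam del) (p u t : ℝ) :
    Continuous fun m => F m p u t := by
  have hL : 0 ≤ Lam := h.lam_pos.le.trans h.lam_le
  refine (LipschitzWith.of_dist_le_mul (K := Lam.toNNReal) fun m m' => ?_).continuous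
  have h1 := h.upper m p u m' p u t
  have h2 := h.upper m' p u m p u t
  have hl := h.lam_pos
  have hle := h.lam_le
  simp only [sub_self, abs_zero, mul_zero, add_zero] at h1 h2
  rw [Real.dist_eq, Real.dist_eq, Real.coe_toNNReal _ hL]
  rcases le_total m m' with hm | hm
  · rw [abs_of_nonpos (a := m - m') (by linarith)]
    rw [max_eq_right (by linarith), max_eq_left (by linarith)] at h1
    rw [max_eq_left (by linarith), max_eq_right (by linarith)] at h2
    rw [abs_le]
    constructor <;> nlinarith
  · rw [abs_of_nonneg (a := m - m') (by linarith)]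
    rw [max_eq_right (by linarith), max_eq_left (by linarith)] at h2
    rw [max_eq_left (by linarith), max_eq_right (by linarith)] at h1
    rw [abs_le]
    constructor <;> nlinarith

theorem apply_solveSecond (h : EllipticHom F lam Lam gam del) (p u t c : ℝ) :
    F (solveSecond F p u t c) p u t = c := by
  refine Function.invFun_eq (f := fun m => F m p u t) ?_
  have hl := h.lam_pos
  set R := |c - F 0 p u t| / lam with hR
  have hR0 : 0 ≤ R := by positivity
  have hlR : lam * R = |c - F 0 p u t| := by rw [hR]; field_simp
  have h1 := h.upper 0 p u R p u t
  have h2 := h.upper (-R) p u 0 p u t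
  simp only [sub_self, abs_zero, mul_zero, add_zero] at h1 h2
  rw [max_eq_right (by linarith), max_eq_left (by linarith)] at h1 h2
  have h3 := neg_abs_le (c - F 0 p u t)
  have h4 := le_abs_self (c - F 0 p u t)
  have := intermediate_value_Icc (show -R ≤ R by linarith)
    (h.continuous_second p u t).continuousOn
  obtain ⟨m, -, hm⟩ := this (show c ∈ Icc (F (-R) p u t) (F R p u t) by
    constructor <;> linarith)
  exact ⟨m, hm⟩

theorem solveSecond_lipschitz (h : EllipticHom F lam Lam gam del) (p u c p' u' c' t : ℝ) :
    lam * |solveSecond F p u t c - solveSecond F p' u' t c'|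
      ≤ |c - c'| + gam * |p - p'| + del * |u - u'| := by
  have := h.mul_abs_sub_le (solveSecond F p u t c) p u (solveSecond F p' u' t c') p' u' t
  rwa [h.apply_solveSecond, h.apply_solveSecond] at this

theorem abs_solveSecond_le (h : EllipticHom F lam Lam gam del) (p u c t : ℝ) :
    lam * |solveSecond F p u t c| ≤ |c| + gam * |p| + del * |u| := by
  have := h.mul_abs_sub_le (solveSecond F p u t c) p u 0 0 0 t
  rwa [h.apply_solveSecond, h.zero, sub_zero, sub_zero, sub_zero, sub_zero] at this

theorem continuous_solveSecond_time (h : EllipticHom F lam Lam gam del) (p u c : ℝ) :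
    Continuous fun t => solveSecond F p u t c := by
  rw [continuous_iff_continuousAt]
  intro t₀
  have hl := h.lam_pos
  set m₀ := solveSecond F p u t₀ c with hm₀
  have hb : ∀ t, dist (solveSecond F p u t c) m₀ ≤ |c - F m₀ p u t| / lam := by
    intro t
    rw [le_div_iff₀ hl, mul_comm, Real.dist_eq]
    have := h.mul_abs_sub_le (solveSecond F p u t c) p u m₀ p u t
    simpa [h.apply_solveSecond] using this
  refine tendsto_iff_dist_tendsto_zero.2 (squeeze_zero (fun _ => dist_nonneg) hb ?_)
  have hc : Continuous fun t => |c - F m₀ p u t| / lam :=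
    ((continuous_const.sub (h.cont m₀ p u)).abs).div_const _
  have := hc.tendsto t₀
  simpa [hm₀, h.apply_solveSecond] using this

/-- Joint continuity of the solved second derivative. -/
theorem continuousOn_solveSecond (h : EllipticHom F lam Lam gam del) {S : Set ℝ}
    {p u c : ℝ → ℝ} (hp : ContinuousOn p S) (hu : ContinuousOn u S) (hc : ContinuousOn c S) :
    ContinuousOn (fun t => solveSecond F (p t) (u t) t (c t)) S := by
  intro t₀ ht₀
  have hl := h.lam_pos
  have hb : ∀ t, dist (solveSecond F (p t) (u t) t (c t)) (solveSecond F (p t₀) (u t₀) t₀ (c t₀))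
      ≤ (|c t - c t₀| + gam * |p t - p t₀| + del * |u t - u t₀|) / lam
        + |solveSecond F (p t₀) (u t₀) t (c t₀) - solveSecond F (p t₀) (u t₀) t₀ (c t₀)| := by
    intro t
    refine (dist_triangle _ (solveSecond F (p t₀) (u t₀) t (c t₀)) _).trans ?_
    rw [Real.dist_eq, Real.dist_eq]
    gcongr
    rw [le_div_iff₀ hl, mul_comm]
    exact h.solveSecond_lipschitz _ _ _ _ _ _ _
  refine tendsto_iff_dist_tendsto_zero.2 (squeeze_zero (fun _ => dist_nonneg) hb ?_)
  have hs := (h.continuous_solveSecond_time (p t₀) (u t₀) (c t₀)).continuousWithinAt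
    (s := S) (x := t₀)
  have hall : ContinuousWithinAt (fun t =>
      (|c t - c t₀| + gam * |p t - p t₀| + del * |u t - u t₀|) / lam
        + |solveSecond F (p t₀) (u t₀) t (c t₀) - solveSecond F (p t₀) (u t₀) t₀ (c t₀)|) S t₀ :=
    (((((hc t₀ ht₀).sub continuousWithinAt_const).abs.add
      (continuousWithinAt_const.mul ((hp t₀ ht₀).sub continuousWithinAt_const).abs)).add
      (continuousWithinAt_const.mul ((hu t₀ ht₀).sub continuousWithinAt_const).abs)).div_const
      _).add (hs.sub continuousWithinAt_const).abs
  have := hall.tendsto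
  simpa using this

end EllipticHom

namespace EllipticHom

variable {F : ℝ → ℝ → ℝ → ℝ → ℝ} {lam Lam gam del : ℝ}

theorem abs_solveSecond_angle_le (h : EllipticHom F lam Lam gam del) (μ θ t : ℝ) :
    |solveSecond F (Real.cos θ) (Real.sin θ) t (-μ * Real.sin θ)| ≤ (|μ| + gam + del) / lam := by
  rw [le_div_iff₀ h.lam_pos, mul_comm]
  refine (h.abs_solveSecond_le _ _ _ _).trans ?_
  rw [abs_mul, abs_neg]
  have hs := Real.abs_sin_le_one θ
  have hc := Real.abs_cos_le_one θ
  have h1 := mul_le_mul_of_nonneg_left hs (abs_nonneg μ)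
  have h2 := mul_le_mul_of_nonneg_left hc h.gam_pos.le
  have h3 := mul_le_mul_of_nonneg_left hs h.del_pos.le
  linarith

theorem angleField_lipschitz (h : EllipticHom F lam Lam gam del) (μ θ θ' t : ℝ) :
    |angleField F μ θ t - angleField F μ θ' t|
      ≤ (2 + 2 * ((|μ| + gam + del) / lam)) * |θ - θ'| := by
  have hl := h.lam_pos
  have hs := Real.abs_sin_sub_sin_le θ θ'
  have hc := Real.abs_cos_sub_cos_le θ θ'
  set C := (|μ| + gam + del) / lam with hC
  set g := solveSecond F (Real.cos θ) (Real.sin θ) t (-μ * Real.sin θ) with hg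
  set g' := solveSecond F (Real.cos θ') (Real.sin θ') t (-μ * Real.sin θ') with hg'
  have hC0 : 0 ≤ C := (abs_nonneg _).trans (h.abs_solveSecond_angle_le μ θ t)
  have hgb : |g| ≤ C := h.abs_solveSecond_angle_le μ θ t
  have hgg : |g - g'| ≤ C * |θ - θ'| := by
    have h0 := h.solveSecond_lipschitz (Real.cos θ) (Real.sin θ) (-μ * Real.sin θ)
      (Real.cos θ') (Real.sin θ') (-μ * Real.sin θ') t
    rw [← hg, ← hg', ← mul_sub, abs_mul, abs_neg] at h0
    have h1 := mul_le_mul_of_nonneg_left hs (abs_nonneg μ)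
    have h2 := mul_le_mul_of_nonneg_left hc h.gam_pos.le
    have h3 := mul_le_mul_of_nonneg_left hs h.del_pos.le
    rw [hC, div_mul_eq_mul_div, le_div_iff₀ hl]
    linarith
  have hsplit : angleField F μ θ t - angleField F μ θ' t
      = (Real.cos θ - Real.cos θ') * (Real.cos θ + Real.cos θ')
        - ((Real.sin θ - Real.sin θ') * g + Real.sin θ' * (g - g')) := by
    simp only [angleField, ← hg, ← hg']
    ring
  have e1 : |(Real.cos θ - Real.cos θ') * (Real.cos θ + Real.cos θ')| ≤ |θ - θ'| * 2 := by
    rw [abs_mul]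
    refine mul_le_mul hc ?_ (abs_nonneg _) (abs_nonneg _)
    have := abs_add_le (Real.cos θ) (Real.cos θ')
    linarith [Real.abs_cos_le_one θ, Real.abs_cos_le_one θ']
  have e2 : |(Real.sin θ - Real.sin θ') * g| ≤ |θ - θ'| * C := by
    rw [abs_mul]
    exact mul_le_mul hs hgb (abs_nonneg _) (abs_nonneg _)
  have e3 : |Real.sin θ' * (g - g')| ≤ 1 * (C * |θ - θ'|) := by
    rw [abs_mul]
    exact mul_le_mul (Real.abs_sin_le_one _) hgg (abs_nonneg _) zero_le_one
  rw [hsplit]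
  refine (abs_sub _ _).trans ?_
  have := abs_add_le ((Real.sin θ - Real.sin θ') * g) (Real.sin θ' * (g - g'))
  linarith

theorem abs_angleField_le (h : EllipticHom F lam Lam gam del) (μ θ t : ℝ) :
    |angleField F μ θ t| ≤ 1 + (|μ| + gam + del) / lam := by
  refine (abs_sub _ _).trans (add_le_add ?_ ?_)
  · rw [abs_of_nonneg (sq_nonneg _)]
    exact Real.cos_sq_le_one θ
  · rw [abs_mul]
    have := mul_le_mul (Real.abs_sin_le_one θ) (h.abs_solveSecond_angle_le μ θ t)
      (abs_nonneg _) zero_le_one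
    linarith

theorem angleField_sub_param_le (h : EllipticHom F lam Lam gam del) (μ ν θ t : ℝ) :
    |angleField F ν θ t - angleField F μ θ t| ≤ |ν - μ| / lam := by
  have hsplit : angleField F ν θ t - angleField F μ θ t = Real.sin θ *
      (solveSecond F (Real.cos θ) (Real.sin θ) t (-μ * Real.sin θ)
        - solveSecond F (Real.cos θ) (Real.sin θ) t (-ν * Real.sin θ)) := by
    simp only [angleField]
    ring
  rw [hsplit, le_div_iff₀ h.lam_pos, abs_mul]
  have h0 := h.solveSecond_lipschitz (Real.cos θ) (Real.sin θ) (-μ * Real.sin θ)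
    (Real.cos θ) (Real.sin θ) (-ν * Real.sin θ) t
  rw [← sub_mul, abs_mul, neg_sub_neg, sub_self, sub_self, abs_zero, mul_zero, mul_zero,
    add_zero, add_zero] at h0
  have hs := Real.abs_sin_le_one θ
  have h1 := mul_le_mul_of_nonneg_left hs (abs_nonneg (ν - μ))
  have h2 := mul_le_mul hs h0 (mul_nonneg h.lam_pos.le (abs_nonneg _)) zero_le_one
  linarith

theorem continuous_angleField_time (h : EllipticHom F lam Lam gam del) (μ θ : ℝ) :
    Continuous fun t => angleField F μ θ t :=
  continuous_const.sub (continuous_const.mul (h.continuous_solveSecond_time _ _ _))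

theorem exists_angle (h : EllipticHom F lam Lam gam del) {a b : ℝ} (hab : a < b) (μ : ℝ) :
    ∃ θ : ℝ → ℝ, θ a = 0 ∧
      ∀ t ∈ Icc a b, HasDerivWithinAt θ (angleField F μ (θ t) t) (Icc a b) t := by
  have hL : 0 ≤ 1 + (|μ| + gam + del) / lam := (abs_nonneg _).trans (h.abs_angleField_le μ 0 0)
  have hK : 0 ≤ 2 + 2 * ((|μ| + gam + del) / lam) := by linarith
  have hA : 0 ≤ (1 + (|μ| + gam + del) / lam) * (b - a) := mul_nonneg hL (by linarith)
  have hpl : IsPicardLindelof (fun t θ => angleField F μ θ t)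
      (⟨a, left_mem_Icc.2 hab.le⟩ : Icc a b) 0
      (Real.toNNReal ((1 + (|μ| + gam + del) / lam) * (b - a))) 0
      (Real.toNNReal (1 + (|μ| + gam + del) / lam))
      (Real.toNNReal (2 + 2 * ((|μ| + gam + del) / lam))) := by
    refine ⟨fun t _ => ?_, fun x _ => (h.continuous_angleField_time μ x).continuousOn, ?_, ?_⟩
    · refine (LipschitzWith.of_dist_le_mul fun x y => ?_).lipschitzOnWith
      rw [Real.dist_eq, Real.dist_eq, Real.coe_toNNReal _ hK]
      exact h.angleField_lipschitz μ x y t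
    · intro t _ x _
      rw [Real.coe_toNNReal _ hL]
      exact h.abs_angleField_le μ x t
    · simp only [Real.coe_toNNReal _ hL, Real.coe_toNNReal _ hA]
      rw [sub_self, max_eq_left (by linarith)]
      simp
  exact hpl.exists_eq_forall_mem_Icc_hasDerivWithinAt₀

/-- Strict subsolutions of the angle equation stay below solutions. -/
theorem barrier_lt (h : EllipticHom F lam Lam gam del) {μ s e : ℝ} {θ φ φ' : ℝ → ℝ}
    (hθc : ContinuousOn θ (Icc s e)) (hφc : ContinuousOn φ (Icc s e))
    (hθ : ∀ t ∈ Ioo s e, HasDerivAt θ (angleField F μ (θ t) t) t)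
    (hφ : ∀ t ∈ Ioo s e, HasDerivAt φ (φ' t) t) (h0 : φ s ≤ θ s)
    (hlt : ∀ t ∈ Ioo s e, φ' t < angleField F μ (φ t) t) : ∀ t ∈ Ioc s e, φ t < θ t := by
  intro t ht
  have := pos_of_deriv_gt_neg_mul_abs (W := fun t => θ t - φ t)
    (K := 2 + 2 * ((|μ| + gam + del) / lam)) (hθc.sub hφc)
    (fun t ht => (hθ t ht).sub (hφ t ht)) (sub_nonneg.2 h0) (fun t ht => ?_) t ht
  · exact sub_pos.1 this
  · have h1 := (abs_le.1 (h.angleField_lipschitz μ (θ t) (φ t) t)).1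
    have h2 := hlt t ht
    linarith

/-- Constant strict supersolutions of the angle equation stay above solutions. -/
theorem lt_barrier_const (h : EllipticHom F lam Lam gam del) {μ s e φ : ℝ} {θ : ℝ → ℝ}
    (hθc : ContinuousOn θ (Icc s e))
    (hθ : ∀ t ∈ Ioo s e, HasDerivAt θ (angleField F μ (θ t) t) t) (h0 : θ s ≤ φ)
    (hlt : ∀ t ∈ Ioo s e, angleField F μ φ t < 0) : ∀ t ∈ Ioc s e, θ t < φ := by
  intro t ht
  have := pos_of_deriv_gt_neg_mul_abs (W := fun t => φ - θ t)
    (K := 2 + 2 * ((|μ| + gam + del) / lam)) (continuousOn_const.sub hθc)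
    (fun t ht => (hθ t ht).const_sub φ) (sub_nonneg.2 h0) (fun t ht => ?_) t ht
  · exact sub_pos.1 this
  · have h1 := (abs_le.1 (h.angleField_lipschitz μ φ (θ t) t)).1
    have h2 := hlt t ht
    linarith

/-- Linear strict subsolutions of the angle equation. -/
theorem barrier_linear (h : EllipticHom F lam Lam gam del) {μ s e p ρ : ℝ} {θ : ℝ → ℝ}
    (hse : s < e) (hθc : ContinuousOn θ (Icc s e))
    (hθ : ∀ t ∈ Ioo s e, HasDerivAt θ (angleField F μ (θ t) t) t) (h0 : p ≤ θ s) (hρ : 0 < ρ)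
    (hlt : ∀ x ∈ Ioo p (p + ρ * (e - s)), ∀ t, ρ < angleField F μ x t) :
    p + ρ * (e - s) < θ e := by
  refine h.barrier_lt (φ := fun t => p + ρ * (t - s)) (φ' := fun _ => ρ) hθc (by fun_prop) hθ
    (fun t _ => ?_) (by simpa using h0) (fun t ht => hlt _ ⟨?_, ?_⟩ t) e ⟨hse, le_rfl⟩
  · simpa using (((hasDerivAt_id t).sub_const s).const_mul ρ).const_add p
  · have := mul_pos hρ (sub_pos.2 ht.1)
    linarith
  · have := mul_lt_mul_of_pos_left (sub_lt_sub_right ht.2 s) hρ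
    linarith

theorem continuous_angle_endpoint (h : EllipticHom F lam Lam gam del) {a b : ℝ} (hab : a < b)
    {θ : ℝ → ℝ → ℝ} (h0 : ∀ μ, θ μ a = 0)
    (hθ : ∀ μ, ∀ t ∈ Icc a b,
      HasDerivWithinAt (θ μ) (angleField F μ (θ μ t) t) (Icc a b) t) :
    Continuous fun μ => θ μ b := by
  rw [continuous_iff_continuousAt]
  intro μ
  have hK : 0 ≤ 2 + 2 * ((|μ| + gam + del) / lam) := by
    have := (abs_nonneg _).trans (h.abs_angleField_le μ 0 0)
    have := (abs_nonneg _).trans (h.abs_solveSecond_angle_le μ 0 0)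
    linarith
  have hder : ∀ ν, ∀ t ∈ Ico a b,
      HasDerivWithinAt (θ ν) (angleField F ν (θ ν t) t) (Ici t) t := fun ν t ht =>
    ((hθ ν t (Ico_subset_Icc_self ht)).mono (Icc_subset_Icc_left ht.1)).mono_of_mem_nhdsWithin
      (Icc_mem_nhdsGE ht.2)
  have hb : ∀ ν, dist (θ ν b) (θ μ b) ≤ gronwallBound 0
      (Real.toNNReal (2 + 2 * ((|μ| + gam + del) / lam))) (|ν - μ| / lam + 0) (b - a) := by
    intro ν
    refine dist_le_of_approx_trajectories_ODE (v := fun t x => angleField F μ x t)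
      (fun t => LipschitzWith.of_dist_le_mul fun x y => ?_)
      (fun t ht => (hθ ν t ht).continuousWithinAt) (hder ν) (fun t _ => ?_)
      (fun t ht => (hθ μ t ht).continuousWithinAt) (hder μ) (fun t _ => (dist_self _).le)
      (by rw [h0, h0, dist_self]) b (right_mem_Icc.2 hab.le)
    · rw [Real.dist_eq, Real.dist_eq, Real.coe_toNNReal _ hK]
      exact h.angleField_lipschitz μ x y t
    · exact h.angleField_sub_param_le μ ν (θ ν t) t
  refine tendsto_iff_dist_tendsto_zero.2 (squeeze_zero (fun _ => dist_nonneg) hb ?_)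
  have hc : Continuous fun ν => gronwallBound 0
      (Real.toNNReal (2 + 2 * ((|μ| + gam + del) / lam))) (|ν - μ| / lam + 0) (b - a) :=
    (gronwallBound_continuous_ε _ _ _).comp
      ((((continuous_id.sub continuous_const).abs).div_const _).add continuous_const)
  have := hc.tendsto μ
  simpa [gronwallBound_ε0_δ0] using this

end EllipticHom

namespace EllipticHom

variable {F : ℝ → ℝ → ℝ → ℝ → ℝ} {lam Lam gam del : ℝ}

/-- For very negative `μ` the angle cannot cross `3π/4`. -/
theorem angleField_neg (h : EllipticHom F lam Lam gam del) (t : ℝ) :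
    angleField F (-(2 * (Lam + gam + del))) (Real.pi - Real.pi / 4) t < 0 := by
  have hl := h.lam_pos
  have hle := h.lam_le
  have hg := h.gam_pos
  have hd := h.del_pos
  simp only [angleField, Real.cos_pi_sub, Real.sin_pi_sub, Real.cos_pi_div_four,
    Real.sin_pi_div_four, neg_neg]
  set s := √2 / 2 with hs
  have hs2 : s ^ 2 = 1 / 2 := by
    rw [hs, div_pow, Real.sq_sqrt (by norm_num)]
    norm_num
  have hs0 : 0 < s := by positivity
  have hs1 : 1 / 2 < s := by nlinarith
  set g := solveSecond F (-s) s t (2 * (Lam + gam + del) * s) with hgdef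
  have hgs : s < g := by
    by_contra! hcon
    have h1 := h.upper g (-s) s 0 0 0 t
    rw [h.zero, h.apply_solveSecond, sub_zero, sub_zero, sub_zero, sub_zero, abs_neg,
      abs_of_pos hs0] at h1
    have h2 := mul_le_mul_of_nonneg_left (max_le hcon hs0.le) (hl.le.trans hle)
    have h3 := mul_nonneg hl.le (le_max_right (-g) 0)
    have h4 : 0 < (Lam + gam + del) * s := mul_pos (by linarith) hs0
    linarith
  nlinarith

theorem solveSecond_angle_bound (h : EllipticHom F lam Lam gam del) {μ θ : ℝ} (t : ℝ)
    (hθ : 0 ≤ Real.sin θ) :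
    lam * max (solveSecond F (Real.cos θ) (Real.sin θ) t (-μ * Real.sin θ)) 0
      - Lam * max (-solveSecond F (Real.cos θ) (Real.sin θ) t (-μ * Real.sin θ)) 0
      ≤ gam - (μ - del) * Real.sin θ := by
  have h1 := h.upper 0 0 0 (solveSecond F (Real.cos θ) (Real.sin θ) t (-μ * Real.sin θ))
    (Real.cos θ) (Real.sin θ) t
  rw [h.zero, h.apply_solveSecond, zero_sub, zero_sub, zero_sub, zero_sub, neg_neg, abs_neg,
    abs_neg, abs_of_nonneg hθ] at h1
  have h2 := mul_le_mul_of_nonneg_left (Real.abs_cos_le_one θ) h.gam_pos.le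
  linarith

/-- Slow but definite rotation near the zeros of the solution. -/
theorem angleField_gt_of_sin_small (h : EllipticHom F lam Lam gam del) {μ θ ε : ℝ} (t : ℝ)
    (hμ : del ≤ μ) (hθ : 0 ≤ Real.sin θ) (hε : Real.sin θ ≤ ε) (hε₁ : ε ≤ 1 / 2)
    (hε₂ : ε * gam ≤ lam / 4) : 1 / 4 < angleField F μ θ t := by
  have hl := h.lam_pos
  have hg := h.gam_pos
  have hb := h.solveSecond_angle_bound (μ := μ) t hθ
  have hcs := Real.sin_sq_add_cos_sq θ
  simp only [angleField]
  set g := solveSecond F (Real.cos θ) (Real.sin θ) t (-μ * Real.sin θ)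
  set s := Real.sin θ
  have hsg : s * g ≤ 1 / 4 := by
    rcases le_total g 0 with hg0 | hg0
    · nlinarith
    · rw [max_eq_left hg0, max_eq_right (by linarith)] at hb
      have h1 : lam * g ≤ gam := by nlinarith
      have h2 : s * (lam * g) ≤ lam / 4 :=
        ((mul_le_mul_of_nonneg_left h1 hθ).trans (mul_le_mul_of_nonneg_right hε hg.le)).trans hε₂
      by_contra! hcon
      nlinarith
  nlinarith

/-- Arbitrarily fast rotation away from the zeros of the solution. -/
theorem angleField_gt_of_sin_large (h : EllipticHom F lam Lam gam del) {μ θ σ ρ : ℝ} (t : ℝ)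
    (hσ : 0 < σ) (hρ : 0 ≤ ρ) (hθ : σ ≤ Real.sin θ)
    (hμ : μ = del + (gam + Lam * ((ρ + 1) / σ)) / σ) : ρ < angleField F μ θ t := by
  have hl := h.lam_pos
  have hg := h.gam_pos
  have hL : 0 < Lam := hl.trans_le h.lam_le
  have hb := h.solveSecond_angle_bound (μ := μ) t (hσ.le.trans hθ)
  simp only [angleField]
  set g := solveSecond F (Real.cos θ) (Real.sin θ) t (-μ * Real.sin θ)
  set s := Real.sin θ
  set R := (ρ + 1) / σ with hR
  have hR0 : 0 < R := by positivity
  have hσR : σ * R = ρ + 1 := by rw [hR]; field_simp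
  have hLR := mul_pos hL hR0
  have hμσ : (μ - del) * σ = gam + Lam * R := by
    rw [hμ]; field_simp; ring
  have hμ0 : 0 ≤ μ - del := by
    rw [hμ, add_sub_cancel_left]; positivity
  have hμs := mul_le_mul_of_nonneg_left hθ hμ0
  have hgR : R ≤ -g := by
    rcases le_total 0 g with hg0 | hg0
    · rw [max_eq_left hg0, max_eq_right (by linarith)] at hb
      have := mul_nonneg hl.le hg0
      linarith
    · rw [max_eq_right hg0, max_eq_left (by linarith)] at hb
      have h1 : Lam * R ≤ Lam * -g := by linarith
      exact le_of_mul_le_mul_left h1 hL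
  have h2 : σ * R ≤ s * -g := mul_le_mul hθ hgR hR0.le (hσ.le.trans hθ)
  nlinarith [sq_nonneg (Real.cos θ)]

theorem exists_angle_gt_pi (h : EllipticHom F lam Lam gam del) {a b : ℝ} (hab : a < b) :
    ∃ μ, ∀ θ : ℝ → ℝ, θ a = 0 → ContinuousOn θ (Icc a b) →
      (∀ t ∈ Ioo a b, HasDerivAt θ (angleField F μ (θ t) t) t) → Real.pi < θ b := by
  have hl := h.lam_pos
  have hg := h.gam_pos
  have hpi := Real.pi_gt_three
  obtain ⟨L, hL⟩ : ∃ L, L = (b - a) / 3 := ⟨_, rfl⟩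
  have hL0 : 0 < L := by rw [hL]; linarith
  obtain ⟨ε, hε0, hεL, hε₁, hε₂⟩ : ∃ ε : ℝ, 0 < ε ∧ ε ≤ L / 4 ∧ ε ≤ 1 / 2 ∧ ε * gam ≤ lam / 4 := by
    refine ⟨min (L / 4) (min (1 / 2) (lam / (4 * gam))), by positivity, min_le_left _ _,
      (min_le_right _ _).trans (min_le_left _ _), ?_⟩
    have := (min_le_right (L / 4) (min (1 / 2) (lam / (4 * gam)))).trans (min_le_right _ _)
    calc _ ≤ lam / (4 * gam) * gam := mul_le_mul_of_nonneg_right this hg.le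
      _ = lam / 4 := by field_simp
  have hεL' : ε / L ≤ 1 / 4 := by
    rw [div_le_iff₀ hL0]; linarith
  have hσ : 0 < Real.sin ε := Real.sin_pos_of_pos_of_lt_pi hε0 (by linarith)
  obtain ⟨ρ, hρ⟩ : ∃ ρ, ρ = (Real.pi - 2 * ε) / L := ⟨_, rfl⟩
  have hρ0 : 0 < ρ := by rw [hρ]; exact div_pos (by linarith) hL0
  have hρL : ρ * L = Real.pi - 2 * ε := by rw [hρ]; field_simp
  have hεLL : ε / L * L = ε := by field_simp
  obtain ⟨μ, hμ⟩ : ∃ μ, μ = del + (gam + Lam * ((ρ + 1) / Real.sin ε)) / Real.sin ε := ⟨_, rfl⟩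
  have hμd : del ≤ μ := by
    have : 0 < Lam := hl.trans_le h.lam_le
    rw [hμ, le_add_iff_nonneg_right]
    positivity
  refine ⟨μ, fun θ h0 hc hd => ?_⟩
  have s1 : 0 + ε / L * (a + L - a) < θ (a + L) := by
    refine h.barrier_linear (by linarith) (hc.mono (Icc_subset_Icc_right (by linarith)))
      (fun t ht => hd t ⟨ht.1, by linarith [ht.2]⟩) h0.ge (by positivity) fun x hx t => ?_
    rw [add_sub_cancel_left, hεLL, zero_add] at hx
    refine hεL'.trans_lt (h.angleField_gt_of_sin_small t hμd
      (Real.sin_nonneg_of_nonneg_of_le_pi hx.1.le (by linarith [hx.2]))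
      ((Real.sin_le hx.1.le).trans hx.2.le) hε₁ hε₂)
  rw [add_sub_cancel_left, hεLL, zero_add] at s1
  have s2 : ε + ρ * (a + 2 * L - (a + L)) < θ (a + 2 * L) := by
    refine h.barrier_linear (by linarith)
      (hc.mono (Icc_subset_Icc (by linarith) (by linarith)))
      (fun t ht => hd t ⟨by linarith [ht.1], by linarith [ht.2]⟩) s1.le hρ0 fun x hx t => ?_
    have hx2 : x < Real.pi - ε := by
      have := hx.2
      rw [show a + 2 * L - (a + L) = L by ring, hρL] at this
      linarith
    refine h.angleField_gt_of_sin_large t hσ hρ0.le ?_ hμ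
    rcases le_total x (Real.pi / 2) with hxp | hxp
    · exact Real.sin_le_sin_of_le_of_le_pi_div_two (by linarith) hxp hx.1.le
    · rw [← Real.sin_pi_sub x]
      exact Real.sin_le_sin_of_le_of_le_pi_div_two (by linarith) (by linarith) (by linarith)
  rw [show a + 2 * L - (a + L) = L by ring, hρL,
    show ε + (Real.pi - 2 * ε) = Real.pi - ε by ring] at s2
  have s3 : Real.pi - ε + ε / L * (b - (a + 2 * L)) < θ b := by
    refine h.barrier_linear (by linarith)
      (hc.mono (Icc_subset_Icc_left (by linarith)))
      (fun t ht => hd t ⟨by linarith [ht.1], ht.2⟩) s2.le (by positivity) fun x hx t => ?_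
    rw [show b - (a + 2 * L) = L by rw [hL]; ring, hεLL] at hx
    have hx1 := hx.1
    have hx2 := hx.2
    refine hεL'.trans_lt (h.angleField_gt_of_sin_small t hμd
      (Real.sin_nonneg_of_nonneg_of_le_pi (by linarith) (by linarith)) ?_ hε₁ hε₂)
    rw [← Real.sin_pi_sub x]
    exact (Real.sin_le (by linarith)).trans (by linarith)
  rw [show b - (a + 2 * L) = L by rw [hL]; ring, hεLL] at s3
  linarith

theorem exists_angle_eq_pi (h : EllipticHom F lam Lam gam del) {a b : ℝ} (hab : a < b) :
    ∃ μ, ∃ θ : ℝ → ℝ, θ a = 0 ∧ θ b = Real.pi ∧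
      (∀ t ∈ Icc a b, HasDerivWithinAt θ (angleField F μ (θ t) t) (Icc a b) t) ∧
      ∀ t ∈ Ioo a b, θ t ∈ Ioo 0 Real.pi := by
  choose θ h0 hθ using fun μ => h.exists_angle hab μ
  have hc : ∀ μ, ContinuousOn (θ μ) (Icc a b) := fun μ t ht => (hθ μ t ht).continuousWithinAt
  have hd : ∀ μ, ∀ t ∈ Ioo a b, HasDerivAt (θ μ) (angleField F μ (θ μ t) t) t := fun μ t ht =>
    (hθ μ t (Ioo_subset_Icc_self ht)).hasDerivAt (Icc_mem_nhds ht.1 ht.2)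
  have hbb : b ∈ Ioc a b := right_mem_Ioc.2 hab
  have hpi := Real.pi_pos
  obtain ⟨μ₁, hμ₁⟩ := h.exists_angle_gt_pi hab
  have hhigh := hμ₁ (θ μ₁) (h0 μ₁) (hc μ₁) (hd μ₁)
  have hlow := h.lt_barrier_const (hc _) (hd _) (by rw [h0]; linarith)
    (fun t _ => h.angleField_neg t) b hbb
  obtain ⟨μ, hμ⟩ := mem_range_of_exists_le_of_exists_ge
    (h.continuous_angle_endpoint hab h0 hθ) ⟨_, (show _ ≤ Real.pi by linarith)⟩ ⟨_, hhigh.le⟩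
  refine ⟨μ, θ μ, h0 μ, hμ, hθ μ, fun t ht => ⟨?_, ?_⟩⟩
  · refine h.barrier_lt (φ := fun _ => 0) (φ' := fun _ => 0) (hc μ) continuousOn_const (hd μ)
      (fun t _ => hasDerivAt_const t 0) (h0 μ).ge (fun t _ => ?_) t (Ioo_subset_Ioc_self ht)
    simp [angleField]
  · by_contra! hcon
    have := h.barrier_lt (φ := fun _ => Real.pi) (φ' := fun _ => 0) (s := t) (e := b)
      ((hc μ).mono (Icc_subset_Icc_left ht.1.le)) continuousOn_const
      (fun x hx => hd μ x ⟨ht.1.trans hx.1, hx.2⟩) (fun t _ => hasDerivAt_const t _) hcon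
      (fun t _ => by simp [angleField]) b (right_mem_Ioc.2 ht.2)
    exact this.ne' hμ

theorem exists_pos_eigenpair (h : EllipticHom F lam Lam gam del) {a b : ℝ} (hab : a < b) :
    ∃ μ, ∃ u u' u'' : ℝ → ℝ, IsEigenpair F a b μ u u' u'' ∧ ∀ t ∈ Ioo a b, 0 < u t := by
  obtain ⟨μ, θ, h0, hpi, hθ, hmem⟩ := h.exists_angle_eq_pi hab
  have hθc : ContinuousOn θ (Icc a b) := fun t ht => (hθ t ht).continuousWithinAt
  have hcos := Real.continuous_cos.comp_continuousOn hθc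
  have hsin := Real.continuous_sin.comp_continuousOn hθc
  obtain ⟨g, hg⟩ : ∃ g : ℝ → ℝ, g = fun t =>
    solveSecond F (Real.cos (θ t)) (Real.sin (θ t)) t (-μ * Real.sin (θ t)) := ⟨_, rfl⟩
  have hgc : ContinuousOn g (Icc a b) := by
    rw [hg]
    exact h.continuousOn_solveSecond hcos hsin (continuousOn_const.mul hsin)
  have hθ' : ∀ t ∈ Icc a b, HasDerivWithinAt θ
      (Real.cos (θ t) ^ 2 - Real.sin (θ t) * g t) (Icc a b) t := by
    rw [hg]; exact hθ
  have hFg : ∀ t, F (g t) (Real.cos (θ t)) (Real.sin (θ t)) t = -μ * Real.sin (θ t) := by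
    rw [hg]; exact fun t => h.apply_solveSecond _ _ _ _
  obtain ⟨q, hq⟩ : ∃ q : ℝ → ℝ,
    q = fun t => Real.cos (θ t) * Real.sin (θ t) + Real.cos (θ t) * g t := ⟨_, rfl⟩
  have hqc : ContinuousOn q (Icc a b) := by
    rw [hq]; exact (hcos.mul hsin).add (hcos.mul hgc)
  obtain ⟨r, hr⟩ : ∃ r : ℝ → ℝ,
    r = fun t => Real.exp (∫ x in a..t, IccExtend hab.le ((Icc a b).domRestrict q) x) := ⟨_, rfl⟩
  have hrpos : ∀ t, 0 < r t := by
    rw [hr]; exact fun t => Real.exp_pos _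
  have hrd : ∀ t ∈ Icc a b, HasDerivWithinAt r (r t * q t) (Icc a b) t := by
    intro t ht
    have hcont : Continuous (IccExtend hab.le ((Icc a b).domRestrict q)) :=
      (continuousOn_iff_continuous_domRestrict.1 hqc).Icc_extend'
    have h1 := (hcont.integral_hasStrictDerivAt a t).hasDerivAt.exp
    rw [IccExtend_of_mem hab.le _ ht, domRestrict_apply] at h1
    rw [hr]
    exact h1.hasDerivWithinAt
  have hrc : ContinuousOn r (Icc a b) := fun t ht => (hrd t ht).continuousWithinAt
  have hu : ∀ t ∈ Icc a b, HasDerivWithinAt (fun t => r t * Real.sin (θ t))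
      (r t * Real.cos (θ t)) (Icc a b) t := by
    intro t ht
    refine ((hrd t ht).mul (hθ' t ht).sin).congr_deriv ?_
    rw [hq]
    linear_combination (r t * Real.cos (θ t)) * Real.sin_sq_add_cos_sq (θ t)
  have hu' : ∀ t ∈ Icc a b, HasDerivWithinAt (fun t => r t * Real.cos (θ t))
      (r t * g t) (Icc a b) t := by
    intro t ht
    refine ((hrd t ht).mul (hθ' t ht).cos).congr_deriv ?_
    rw [hq]
    linear_combination (r t * g t) * Real.sin_sq_add_cos_sq (θ t)
  refine ⟨μ, fun t => r t * Real.sin (θ t), fun t => r t * Real.cos (θ t), fun t => r t * g t,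
    ⟨⟨hu, hrc.mul hcos, fun t ht => (hu' t (Ioo_subset_Icc_self ht)).hasDerivAt
      (Icc_mem_nhds ht.1 ht.2), (hrc.mul hgc).mono Ioo_subset_Icc_self⟩, fun t _ => ?_, ?_, ?_⟩,
    fun t ht => mul_pos (hrpos t) (Real.sin_pos_of_mem_Ioo (hmem t ht))⟩
  · rw [h.hom _ (hrpos t).le, hFg]
    ring
  · simp [h0]
  · simp [hpi]

theorem wronskian_eq_zero (h : EllipticHom F lam Lam gam del) {a b : ℝ} (hab : a < b)
    {μ ν : ℝ} {v v' v'' w w' w'' : ℝ → ℝ} (hv : IsEigenpair F a b μ v v' v'')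
    (hw : IsEigenpair F a b ν w w' w'') (hvpos : ∀ t ∈ Ioo a b, 0 < v t)
    (hwpos : ∀ t ∈ Ioo a b, 0 < w t) (hμν : μ ≤ ν) :
    μ = ν ∧ ∀ t ∈ Icc a b, v' t * w t - v t * w' t = 0 := by
  obtain ⟨⟨hv1, hv2, hv3, -⟩, hveq, hva, hvb⟩ := hv
  obtain ⟨⟨hw1, hw2, hw3, -⟩, hweq, hwa, hwb⟩ := hw
  have hl := h.lam_pos
  have hd : ∀ t ∈ Ioo a b, HasDerivAt (fun t => v' t * w t - v t * w' t)
      (v'' t * w t - v t * w'' t) t := by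
    intro t ht
    have hmem := Icc_mem_nhds ht.1 ht.2
    have dv := (hv1 t (Ioo_subset_Icc_self ht)).hasDerivAt hmem
    have dw := (hw1 t (Ioo_subset_Icc_self ht)).hasDerivAt hmem
    exact (((hv3 t ht).mul dw).sub (dv.mul (hw3 t ht))).congr_deriv (by ring)
  have hc : ContinuousOn (fun t => v' t * w t - v t * w' t) (Icc a b) :=
    (hv2.mul fun t ht => (hw1 t ht).continuousWithinAt).sub
      (ContinuousOn.mul (fun t ht => (hv1 t ht).continuousWithinAt) hw2)
  have key : ∀ t ∈ Ioo a b, (ν - μ) * (v t * w t)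
      ≤ Lam * max (v'' t * w t - v t * w'' t) 0 - lam * max (-(v'' t * w t - v t * w'' t)) 0
        + gam * |v' t * w t - v t * w' t| := by
    intro t ht
    have h1 := h.upper (w t * v'' t) (w t * v' t) (w t * v t) (v t * w'' t) (v t * w' t)
      (v t * w t) t
    rw [h.hom _ (hwpos t ht).le, h.hom _ (hvpos t ht).le, hveq t ht, hweq t ht,
      mul_comm (w t) (v t), sub_self, abs_zero, mul_zero, add_zero, mul_comm (w t) (v'' t),
      mul_comm (w t) (v' t)] at h1
    linarith
  have hzero := eq_zero_of_deriv_ge_neg_mul_abs (K := gam / lam) hc hd (by simp [hva, hwa])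
    (by simp [hvb, hwb]) fun t ht => by
      have h1 := key t ht
      have h2 := mul_nonneg (sub_nonneg.2 hμν) (mul_pos (hvpos t ht) (hwpos t ht)).le
      have h3 := mul_nonneg (div_pos h.gam_pos hl).le (abs_nonneg (v' t * w t - v t * w' t))
      rcases le_total 0 (v'' t * w t - v t * w'' t) with hs | hs
      · linarith
      · rw [max_eq_right hs, max_eq_left (by linarith)] at h1
        have h4 : lam * (gam / lam * |v' t * w t - v t * w' t|)
            = gam * |v' t * w t - v t * w' t| := by field_simp
        have h5 : lam * (-(gam / lam * |v' t * w t - v t * w' t|))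
            ≤ lam * (v'' t * w t - v t * w'' t) := by linarith
        have := le_of_mul_le_mul_left h5 hl
        linarith
  refine ⟨le_antisymm hμν ?_, hzero⟩
  obtain ⟨t, ht⟩ := nonempty_Ioo.2 hab
  have hd0 : v'' t * w t - v t * w'' t = 0 := by
    refine (hd t ht).unique ((hasDerivAt_const t (0 : ℝ)).congr_of_eventuallyEq ?_)
    filter_upwards [Icc_mem_nhds ht.1 ht.2] with x hx using hzero x hx
  have h1 := key t ht
  rw [hd0, hzero t (Ioo_subset_Icc_self ht)] at h1
  simp only [neg_zero, max_self, mul_zero, sub_zero, abs_zero, add_zero] at h1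
  have := nonpos_of_mul_nonpos_left h1 (mul_pos (hvpos t ht) (hwpos t ht))
  linarith

theorem pos_eigenpair_unique (h : EllipticHom F lam Lam gam del) {a b : ℝ} (hab : a < b)
    {μ ν : ℝ} {v v' v'' w w' w'' : ℝ → ℝ} (hv : IsEigenpair F a b μ v v' v'')
    (hw : IsEigenpair F a b ν w w' w'') (hvpos : ∀ t ∈ Ioo a b, 0 < v t)
    (hwpos : ∀ t ∈ Ioo a b, 0 < w t) :
    μ = ν ∧ ∃ c : ℝ, 0 < c ∧ ∀ t ∈ Icc a b, v t = c * w t := by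
  obtain ⟨heq, hW⟩ : μ = ν ∧ ∀ t ∈ Icc a b, v' t * w t - v t * w' t = 0 := by
    rcases le_total μ ν with hle | hle
    · exact h.wronskian_eq_zero hab hv hw hvpos hwpos hle
    · obtain ⟨h1, h2⟩ := h.wronskian_eq_zero hab hw hv hwpos hvpos hle
      exact ⟨h1.symm, fun t ht => by linarith [h2 t ht]⟩
  refine ⟨heq, ?_⟩
  obtain ⟨⟨hv1, -⟩, -, hva, hvb⟩ := hv
  obtain ⟨⟨hw1, -⟩, -, hwa, hwb⟩ := hw
  have hd : ∀ t ∈ Ioo a b, HasDerivAt (fun t => v t / w t) 0 t := by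
    intro t ht
    have hmem := Icc_mem_nhds ht.1 ht.2
    have hI := Ioo_subset_Icc_self ht
    exact (((hv1 t hI).hasDerivAt hmem).div ((hw1 t hI).hasDerivAt hmem)
      (hwpos t ht).ne').congr_deriv (by rw [hW t hI, zero_div])
  obtain ⟨t₀, ht₀⟩ := nonempty_Ioo.2 hab
  refine ⟨v t₀ / w t₀, div_pos (hvpos t₀ ht₀) (hwpos t₀ ht₀), fun t ht => ?_⟩
  rcases eq_endpoints_or_mem_Ioo_of_mem_Icc ht with rfl | rfl | hI
  · rw [hva, hwa, mul_zero]
  · rw [hvb, hwb, mul_zero]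
  · have hconst : v t / w t = v t₀ / w t₀ :=
      isOpen_Ioo.is_const_of_deriv_eq_zero isPreconnected_Ioo
        (fun x hx => (hd x hx).differentiableAt.differentiableWithinAt)
        (fun x hx => (hd x hx).deriv) hI ht₀
    rw [← hconst, div_mul_cancel₀ _ (hwpos t hI).ne']

end EllipticHom

theorem IsEigenpair.congr {F G : ℝ → ℝ → ℝ → ℝ → ℝ} {c d μ : ℝ} {u u' u'' : ℝ → ℝ}
    (h : IsEigenpair F c d μ u u' u'') (hFG : ∀ t ∈ Ioo c d, ∀ m p u, F m p u t = G m p u t) :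
    IsEigenpair G c d μ u u' u'' :=
  ⟨h.1, fun t ht => by rw [← hFG t ht]; exact h.2.1 t ht, h.2.2⟩

theorem IsEigenpair.reflect {F : ℝ → ℝ → ℝ → ℝ → ℝ} {c d μ : ℝ} {u u' u'' : ℝ → ℝ}
    (h : IsEigenpair F c d μ u u' u'') :
    IsEigenpair (fun m p u t => -F (-m) (-p) (-u) t) c d μ
      (fun t => -u t) (fun t => -u' t) (fun t => -u'' t) := by
  obtain ⟨⟨h1, h2, h3, h4⟩, heq, hc, hd⟩ := h
  refine ⟨⟨fun t ht => (h1 t ht).neg, h2.neg, fun t ht => (h3 t ht).neg, h4.neg⟩,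
    fun t ht => ?_, by simp [hc], by simp [hd]⟩
  simp only [neg_neg, heq t ht]
  ring

/-- existence of the first eigenpairs `(λ⁺,u⁺)` (positive eigenfunction)
and `(λ⁻,u⁻)` (negative eigenfunction), together with their uniqueness/simplicity. -/
theorem stmt_6
    (a b lam Lam gam del : ℝ) (hab : a < b)
    (hlam : 0 < lam) (hLam : lam ≤ Lam) (hgam : 0 < gam) (hdel : 0 < del)
    (F : ℝ → ℝ → ℝ → ℝ → ℝ)
    (hFcont : ContinuousOn (fun z : ℝ × ℝ × ℝ × ℝ => F z.1 z.2.1 z.2.2.1 z.2.2.2)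
      {z : ℝ × ℝ × ℝ × ℝ | z.2.2.2 ∈ Icc a b})
    (hF1 : ∀ s : ℝ, 0 ≤ s → ∀ m p u : ℝ, ∀ t ∈ Icc a b,
      F (s * m) (s * p) (s * u) t = s * F m p u t)
    (hF2 : ∀ m p u m' p' u' : ℝ, ∀ t ∈ Icc a b,
      lam * max (m - m') 0 - Lam * max (-(m - m')) 0 - gam * |p - p'| - del * |u - u'|
          ≤ F m p u t - F m' p' u' t ∧
        F m p u t - F m' p' u' t
          ≤ Lam * max (m - m') 0 - lam * max (-(m - m')) 0 + gam * |p - p'| + del * |u - u'|)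
    (hF3 : ∀ m p u m' p' u' : ℝ, ∀ t ∈ Icc a b,
      -F (m' - m) (p' - p) (u' - u) t ≤ F m p u t - F m' p' u' t ∧
        F m p u t - F m' p' u' t ≤ F (m - m') (p - p') (u - u') t) :
    ∃ lamP lamM : ℝ, ∃ uP uP' uP'' uM uM' uM'' : ℝ → ℝ,
      IsEigenpair F a b lamP uP uP' uP'' ∧ (∀ t ∈ Ioo a b, 0 < uP t) ∧
      IsEigenpair F a b lamM uM uM' uM'' ∧ (∀ t ∈ Ioo a b, uM t < 0) ∧
      (∀ μ : ℝ, ∀ v v' v'' : ℝ → ℝ,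
        IsEigenpair F a b μ v v' v'' → (∀ t ∈ Ioo a b, 0 < v t) →
        μ = lamP ∧ ∃ c : ℝ, 0 < c ∧ ∀ t ∈ Icc a b, v t = c * uP t) ∧
      (∀ μ : ℝ, ∀ v v' v'' : ℝ → ℝ,
        IsEigenpair F a b μ v v' v'' → (∀ t ∈ Ioo a b, v t < 0) →
        μ = lamM ∧ ∃ c : ℝ, 0 < c ∧ ∀ t ∈ Icc a b, v t = c * uM t) := by
  set G : ℝ → ℝ → ℝ → ℝ → ℝ := fun m p u t => F m p u (projIcc a b hab.le t) with hG
  have hE : EllipticHom G lam Lam gam del :=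
    { lam_pos := hlam
      lam_le := hLam
      gam_pos := hgam
      del_pos := hdel
      cont := fun m p u => hFcont.comp_continuous
        (f := fun t => (m, p, u, (projIcc a b hab.le t : ℝ)))
        (by have := continuous_subtype_val.comp (continuous_projIcc (h := hab.le)); fun_prop)
        fun t => (projIcc a b hab.le t).2
      hom := fun s hs m p u t => hF1 s hs m p u _ (projIcc a b hab.le t).2
      upper := fun m p u m' p' u' t => (hF2 m p u m' p' u' _ (projIcc a b hab.le t).2).2 }
  have hFG : ∀ t ∈ Ioo a b, ∀ m p u, F m p u t = G m p u t := fun t ht m p u => by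
    simp only [hG, projIcc_of_mem hab.le (Ioo_subset_Icc_self ht)]
  have hGF : ∀ t ∈ Ioo a b, ∀ m p u, G m p u t = F m p u t := fun t ht m p u =>
    (hFG t ht m p u).symm
  obtain ⟨lamP, uP, uP', uP'', hP, hPpos⟩ := hE.exists_pos_eigenpair hab
  obtain ⟨lamM, w, w', w'', hM, hMpos⟩ := hE.neg.exists_pos_eigenpair hab
  have hM' : IsEigenpair G a b lamM (fun t => -w t) (fun t => -w' t) (fun t => -w'' t) := by
    simpa only [neg_neg] using hM.reflect
  refine ⟨lamP, lamM, uP, uP', uP'', _, _, _, hP.congr hGF, hPpos, hM'.congr hGF,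
    fun t ht => neg_neg_of_pos (hMpos t ht), fun μ v v' v'' hv hvpos => ?_,
    fun μ v v' v'' hv hvneg => ?_⟩
  · exact hE.pos_eigenpair_unique hab (hv.congr hFG) hP hvpos hPpos
  · obtain ⟨h1, c, hc, h2⟩ := hE.neg.pos_eigenpair_unique hab (hv.congr hFG).reflect hM
      (fun t ht => neg_pos.2 (hvneg t ht)) hMpos
    exact ⟨h1, c, hc, fun t ht => by linarith [h2 t ht]⟩
end

section
/- (Regularity at the origin.) Assume 𝓕 satisfies (F1), (F2) and (F3). Let f : [0,R] → ℝ be continuous and let u ∈ C²(0,R) ∩ C¹([0,R]) satisfy 𝓕(u''(r), u'(r)/r, u'(r), u(r), r) = f(r) for every r ∈ (0,R), with u'(0) = 0 and u(R) = 0. If the functions r ↦ |u''(r)| and r ↦ |u'(r)/r| are bounded on (0,R), then the limit lim_{r→0⁺} u'(r)/r exists; consequently lim_{r→0⁺} u''(r) exists and the second derivative of u at 0 is well defined. -/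
open Set

/-- The radial Pucci-type maximal operator `P⁺(x,y) = Λ(x⁺+(N-1)y⁺) - λ(x⁻+(N-1)y⁻)`. -/
noncomputable def Pplus (N : ℕ) (lam Lam : ℝ) (x y : ℝ) : ℝ :=
  Lam * (max x 0 + ((N : ℝ) - 1) * max y 0) - lam * (max (-x) 0 + ((N : ℝ) - 1) * max (-y) 0)

/-- The radial Pucci-type minimal operator `P⁻(x,y) = λ(x⁺+(N-1)y⁺) - Λ(x⁻+(N-1)y⁻)`. -/
noncomputable def Pminus (N : ℕ) (lam Lam : ℝ) (x y : ℝ) : ℝ :=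
  lam * (max x 0 + ((N : ℝ) - 1) * max y 0) - Lam * (max (-x) 0 + ((N : ℝ) - 1) * max (-y) 0)

/-- `u ∈ C²(e,R) ∩ C¹([e,R])`, with first derivative `u'` (one-sided at the endpoints)
and second derivative `u''` on the open interval. -/
def RadC2 (e R : ℝ) (u u' u'' : ℝ → ℝ) : Prop :=
  (∀ r ∈ Set.Icc e R, HasDerivWithinAt u (u' r) (Set.Icc e R) r) ∧
  ContinuousOn u' (Set.Icc e R) ∧
  (∀ r ∈ Set.Ioo e R, HasDerivAt u' (u'' r) r) ∧
  ContinuousOn u'' (Set.Ioo e R)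

theorem le_Pminus {N : ℕ} (hN : 1 ≤ N) {lam Lam : ℝ} (hlam : 0 ≤ lam) {x : ℝ} (hx : 0 ≤ x)
    (y : ℝ) : lam * x - Lam * (((N : ℝ) - 1) * max (-y) 0) ≤ Pminus N lam Lam x y := by
  have hN' : (0 : ℝ) ≤ (N : ℝ) - 1 := by
    have : (1 : ℝ) ≤ N := by exact_mod_cast hN
    linarith
  have h : 0 ≤ lam * (((N : ℝ) - 1) * max y 0) :=
    mul_nonneg hlam (mul_nonneg hN' (le_max_right _ _))
  unfold Pminus
  rw [max_eq_left hx, max_eq_right (by linarith : -x ≤ 0)]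
  nlinarith

/-- A function which starts at a nonpositive value and has negative derivative wherever it is
positive stays nonpositive. -/
theorem nonpos_of_deriv_neg_of_pos {h h' : ℝ → ℝ} {a b : ℝ} (hc : ContinuousOn h (Ico a b))
    (ha : h a ≤ 0) (hd : ∀ x ∈ Ioo a b, HasDerivAt h (h' x) x)
    (hneg : ∀ x ∈ Ioo a b, 0 < h x → h' x < 0) : ∀ y ∈ Ioo a b, h y ≤ 0 := by
  intro y hy
  by_contra! hpos
  obtain ⟨x, hx, hmax⟩ := isCompact_Icc.exists_isMaxOn (nonempty_Icc.2 hy.1.le)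
    (hc.mono (Icc_subset_Ico_right hy.2))
  have hxpos : 0 < h x := hpos.trans_le (hmax (right_mem_Icc.2 hy.1.le))
  have hax : a < x := lt_of_le_of_ne hx.1 (by rintro rfl; linarith)
  have hxm : x ∈ Ioo a b := ⟨hax, hx.2.trans_lt hy.2⟩
  have hs := (hasDerivAt_iff_tendsto_slope.1 (hd x hxm)).eventually
    (gt_mem_nhds (hneg x hxm hxpos))
  have hs' := hs.filter_mono (nhdsLT_le_nhdsNE x)
  obtain ⟨z, hz, hzm⟩ := (hs'.and (Ioo_mem_nhdsLT hax)).exists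
  have hle : h z ≤ h x := hmax ⟨hzm.1.le, hzm.2.le.trans hx.2⟩
  have hge : 0 ≤ slope h x z := by
    rw [slope_def_field]
    exact div_nonneg_of_nonpos (by linarith) (by linarith [hzm.2])
  linarith

/-- regularity at the origin: if `u` solves the radial equation on `(0,R)`
with `u'(0) = 0`, `u(R) = 0`, and `u''` and `u'/r` are bounded, then `u'(r)/r` has a
limit as `r → 0⁺`, and consequently `u''` has a limit at `0⁺`, so `u''(0)` is well
defined. -/
theorem stmt_12
    (N : ℕ) (hN : 1 ≤ N) (R lam Lam gam del : ℝ) (hR : 0 < R)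
    (hlam : 0 < lam) (hLam : lam ≤ Lam) (hgam : 0 < gam) (hdel : 0 < del)
    (FF : ℝ → ℝ → ℝ → ℝ → ℝ → ℝ)
    (hFcont : ContinuousOn
      (fun z : ℝ × ℝ × ℝ × ℝ × ℝ => FF z.1 z.2.1 z.2.2.1 z.2.2.2.1 z.2.2.2.2)
      {z : ℝ × ℝ × ℝ × ℝ × ℝ | z.2.2.2.2 ∈ Icc 0 R})
    (hF1 : ∀ s : ℝ, 0 ≤ s → ∀ m l p u : ℝ, ∀ r ∈ Icc (0 : ℝ) R,
      FF (s * m) (s * l) (s * p) (s * u) r = s * FF m l p u r)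
    (hF2 : ∀ m l p u m' l' p' u' : ℝ, ∀ r ∈ Icc (0 : ℝ) R,
      Pminus N lam Lam (m - m') (l - l') - gam * |p - p'| - del * |u - u'|
          ≤ FF m l p u r - FF m' l' p' u' r ∧
        FF m l p u r - FF m' l' p' u' r
          ≤ Pplus N lam Lam (m - m') (l - l') + gam * |p - p'| + del * |u - u'|)
    (hF3 : ∀ m l p u m' l' p' u' : ℝ, ∀ r ∈ Icc (0 : ℝ) R,
      -FF (m' - m) (l' - l) (p' - p) (u' - u) r ≤ FF m l p u r - FF m' l' p' u' r ∧
        FF m l p u r - FF m' l' p' u' r ≤ FF (m - m') (l - l') (p - p') (u - u') r)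
    (f : ℝ → ℝ) (hf : ContinuousOn f (Icc 0 R))
    (u u' u'' : ℝ → ℝ) (hu : RadC2 0 R u u' u'')
    (heq : ∀ r ∈ Ioo (0 : ℝ) R, FF (u'' r) (u' r / r) (u' r) (u r) r = f r)
    (hu0 : u' 0 = 0) (huR : u R = 0)
    (hbd : ∃ C : ℝ, ∀ r ∈ Ioo (0 : ℝ) R, |u'' r| ≤ C ∧ |u' r / r| ≤ C) :
    (∃ L : ℝ, Filter.Tendsto (fun r => u' r / r) (nhdsWithin 0 (Ioi 0)) (nhds L)) ∧
    (∃ m₀ : ℝ, Filter.Tendsto u'' (nhdsWithin 0 (Ioi 0)) (nhds m₀)) := by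
  obtain ⟨C, hC⟩ := hbd
  obtain ⟨hu1, hu'c, hu'd, -⟩ := hu
  have h0 : (0 : ℝ) ∈ Icc 0 R := left_mem_Icc.2 hR.le
  have huc : ContinuousOn u (Icc 0 R) := fun r hr => (hu1 r hr).continuousWithinAt
  have hle : nhdsWithin (0 : ℝ) (Ioi 0) ≤ nhdsWithin 0 (Icc 0 R) := by
    rw [← nhdsWithin_Ioo_eq_nhdsGT hR]
    exact nhdsWithin_mono _ Ioo_subset_Icc_self
  have hmem : ∀ᶠ r in nhdsWithin (0 : ℝ) (Ioi 0), r ∈ Ioo 0 R := Ioo_mem_nhdsGT hR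
  have hasymp : ∀ ε > 0, ∀ᶠ r in nhdsWithin (0 : ℝ) (Ioi 0),
      |FF (u'' r) (u' r / r) 0 (u 0) 0 - f 0| < ε := by
    intro ε hε
    let K : Set (ℝ × ℝ × ℝ × ℝ × ℝ) :=
      Icc (-C) C ×ˢ Icc (-C) C ×ˢ (u' '' Icc 0 R) ×ˢ (u '' Icc 0 R) ×ˢ Icc 0 R
    have hK : IsCompact K := isCompact_Icc.prod (isCompact_Icc.prod
      ((isCompact_Icc.image_of_continuousOn hu'c).prod
        ((isCompact_Icc.image_of_continuousOn huc).prod isCompact_Icc)))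
    have hunif := hK.uniformContinuousOn_of_continuous
      (hFcont.mono fun z hz => hz.2.2.2.2)
    obtain ⟨η, hη, hη'⟩ := Metric.uniformContinuousOn_iff.1 hunif (ε / 2) (half_pos hε)
    have e1 := hle (Metric.continuousWithinAt_iff'.1 (hu'c 0 h0) η hη)
    have e2 := hle (Metric.continuousWithinAt_iff'.1 (huc 0 h0) η hη)
    have e3 := hle (Metric.continuousWithinAt_iff'.1 (hf 0 h0) (ε / 2) (half_pos hε))
    filter_upwards [e1, e2, e3, hmem, Ioo_mem_nhdsGT hη] with r h1 h2 h3 hr hrη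
    have hrI := Ioo_subset_Icc_self hr
    obtain ⟨hb1, hb2⟩ := hC r hr
    rw [abs_le] at hb1 hb2
    have key := hη' (u'' r, u' r / r, u' r, u r, r)
      ⟨hb1, hb2, mem_image_of_mem _ hrI, mem_image_of_mem _ hrI, hrI⟩
      (u'' r, u' r / r, 0, u 0, 0)
      ⟨hb1, hb2, ⟨0, h0, hu0⟩, mem_image_of_mem _ h0, h0⟩
      (by
        rw [hu0] at h1
        simp only [Prod.dist_eq, dist_self, max_lt_iff]
        refine ⟨hη, hη, h1, h2, ?_⟩
        rw [Real.dist_eq, sub_zero, abs_of_pos hrη.1]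
        exact hrη.2)
    simp only [heq r hr, Real.dist_eq] at key h3
    rw [abs_lt] at key h3 ⊢
    constructor <;> linarith [key.1, key.2, h3.1, h3.2]
  have hlow : ∀ m l m' l' : ℝ, m' ≤ m →
      lam * (m - m') - Lam * (((N : ℝ) - 1) * max (-(l - l')) 0)
        ≤ FF m l 0 (u 0) 0 - FF m' l' 0 (u 0) 0 := by
    intro m l m' l' hm
    have h := (hF2 m l 0 (u 0) m' l' 0 (u 0) 0 h0).1
    simp only [sub_self, abs_zero, mul_zero, sub_zero] at h
    exact (le_Pminus hN hlam.le (sub_nonneg.2 hm) _).trans h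
  obtain ⟨L, hL⟩ : ∃ L, FF L L 0 (u 0) 0 = f 0 := by
    have hcont : Continuous fun l => FF l l 0 (u 0) 0 :=
      hFcont.comp_continuous (f := fun l : ℝ => (l, l, (0 : ℝ), u 0, (0 : ℝ)))
        (by fun_prop) (fun _ => h0)
    have hmono : ∀ x y : ℝ, x ≤ y → lam * (y - x) ≤ FF y y 0 (u 0) 0 - FF x x 0 (u 0) 0 := by
      intro x y hxy
      have h := hlow y y x x hxy
      rwa [max_eq_right (by linarith), mul_zero, mul_zero, sub_zero] at h
    refine hcont.surjective ?_ ?_ (f 0)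
    · refine Filter.tendsto_atTop_mono' _ ?_ (Filter.tendsto_atTop_add_const_right _
        (FF 0 0 0 (u 0) 0) (Filter.tendsto_id.const_mul_atTop hlam))
      filter_upwards [Filter.eventually_ge_atTop 0] with x hx
      have := hmono 0 x hx
      simp only [id]
      linarith
    · refine Filter.tendsto_atBot_mono' _ ?_ (Filter.tendsto_atBot_add_const_right _
        (FF 0 0 0 (u 0) 0) (Filter.tendsto_id.const_mul_atBot hlam))
      filter_upwards [Filter.eventually_le_atBot 0] with x hx
      have := hmono x 0 hx
      simp only [id]
      linarith
  have hv : ∀ ε > 0, ∀ᶠ r in nhdsWithin (0 : ℝ) (Ioi 0), |u' r / r - L| ≤ ε := by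
    intro ε hε
    have he := (hasymp (lam * ε) (mul_pos hlam hε)).and hmem
    obtain ⟨b, hb, hbs⟩ := mem_nhdsGT_iff_exists_Ioo_subset.1 he
    have hb0 : 0 < b := hb
    have hbR : ∀ r ∈ Ioo 0 b, r ∈ Ioo 0 R := fun r hr => (hbs hr).2
    have hsub : Ico 0 b ⊆ Icc 0 R := by
      intro r hr
      rcases hr.1.eq_or_lt with h | h
      · exact h ▸ h0
      · exact Ioo_subset_Icc_self (hbR r ⟨h, hr.2⟩)
    have hup : ∀ y ∈ Ioo 0 b, u' y - (L + ε) * y ≤ 0 := by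
      refine nonpos_of_deriv_neg_of_pos (h' := fun r => u'' r - (L + ε))
        ((hu'c.mono hsub).sub (by fun_prop)) (by simp [hu0]) ?_ ?_
      · intro x hx
        simpa using (hu'd x (hbR x hx)).fun_sub ((hasDerivAt_id x).const_mul (L + ε))
      · intro x hx hpos
        have hl : L + ε < u' x / x := by rw [lt_div_iff₀ hx.1]; linarith
        have ha := (abs_lt.1 (hbs hx).1).2
        by_contra! hm
        have h := hlow (u'' x) (u' x / x) L L (by linarith)
        rw [max_eq_right (by linarith), mul_zero, mul_zero, sub_zero] at h
        nlinarith
    have hdn : ∀ y ∈ Ioo 0 b, (L - ε) * y - u' y ≤ 0 := by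
      refine nonpos_of_deriv_neg_of_pos (h' := fun r => (L - ε) - u'' r)
        (ContinuousOn.sub (by fun_prop) (hu'c.mono hsub)) (by simp [hu0]) ?_ ?_
      · intro x hx
        simpa using ((hasDerivAt_id x).const_mul (L - ε)).fun_sub (hu'd x (hbR x hx))
      · intro x hx hpos
        have hl : u' x / x < L - ε := by rw [div_lt_iff₀ hx.1]; linarith
        have ha := (abs_lt.1 (hbs hx).1).1
        by_contra! hm
        have h := hlow L L (u'' x) (u' x / x) (by linarith)
        rw [max_eq_right (by linarith), mul_zero, mul_zero, sub_zero] at h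
        nlinarith
    filter_upwards [Ioo_mem_nhdsGT hb0] with r hr
    have h1 : u' r / r ≤ L + ε := by rw [div_le_iff₀ hr.1]; linarith [hup r hr]
    have h2 : L - ε ≤ u' r / r := by rw [le_div_iff₀ hr.1]; linarith [hdn r hr]
    rw [abs_le]
    constructor <;> linarith
  refine ⟨⟨L, ?_⟩, L, ?_⟩
  · refine Metric.tendsto_nhds.2 fun ε hε => ?_
    filter_upwards [hv (ε / 2) (half_pos hε)] with r hr
    rw [Real.dist_eq]
    linarith
  · refine Metric.tendsto_nhds.2 fun ε hε => ?_
    have hN' : (0 : ℝ) ≤ (N : ℝ) - 1 := by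
      have : (1 : ℝ) ≤ N := by exact_mod_cast hN
      linarith
    set A : ℝ := Lam * ((N : ℝ) - 1) with hA
    have hA0 : 0 ≤ A := mul_nonneg (hlam.le.trans hLam) hN'
    have hη : 0 < lam * ε / (1 + A) := by positivity
    filter_upwards [hv _ hη, hasymp _ hη] with r h1 h2
    have hsum : A * (lam * ε / (1 + A)) + lam * ε / (1 + A) = lam * ε := by field_simp; ring
    obtain ⟨h1a, h1b⟩ := abs_le.1 h1
    obtain ⟨h2a, h2b⟩ := abs_lt.1 h2
    rw [Real.dist_eq, abs_lt]
    constructor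
    · by_contra! hm
      have h := hlow L L (u'' r) (u' r / r) (by linarith)
      have hmax : max (-(L - u' r / r)) 0 ≤ lam * ε / (1 + A) :=
        max_le (by linarith) hη.le
      have := mul_le_mul_of_nonneg_left hmax hA0
      rw [← mul_assoc, ← hA] at h
      nlinarith
    · by_contra! hm
      have h := hlow (u'' r) (u' r / r) L L (by linarith)
      have hmax : max (-(u' r / r - L)) 0 ≤ lam * ε / (1 + A) :=
        max_le (by linarith) hη.le
      have := mul_le_mul_of_nonneg_left hmax hA0
      rw [← mul_assoc, ← hA] at h
      nlinarith
end

section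
/- (Radial comparison principle.) Assume 𝓕 satisfies (F1), (F2) and (F3), and additionally that for each fixed (m,ℓ,p,r) the map u ↦ 𝓕(m,ℓ,p,u,r) is decreasing. If u, v ∈ C²(0,R) ∩ C¹([0,R]) satisfy 𝓕(u''(r), u'(r)/r, u'(r), u(r), r) ≥ 𝓕(v''(r), v'(r)/r, v'(r), v(r), r) for all r ∈ (0,R), and u(R) = v(R), u'(0) = v'(0) = 0, then u ≤ v on [0,R]. -/
open Set

open Filter Topology

/-- The derivative of a function at a point which minimizes it over an interval on the left
is nonpositive. -/
theorem HasDerivAt.nonpos_of_forall_le_left {f : ℝ → ℝ} {f' a s : ℝ} (hf : HasDerivAt f f' s)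
    (has : a < s) (hmin : ∀ y ∈ Ioo a s, f s ≤ f y) : f' ≤ 0 := by
  have h := (hasDerivAt_iff_tendsto_slope.1 hf).mono_left
    (nhdsWithin_mono s (fun y (hy : y < s) => ne_of_lt hy) : 𝓝[<] s ≤ 𝓝[≠] s)
  refine le_of_tendsto h ?_
  filter_upwards [Ioo_mem_nhdsLT has] with y hy
  rw [slope_def_field]
  exact div_nonpos_of_nonneg_of_nonpos (by linarith [hmin y hy]) (by linarith [hy.2])

theorem Pplus_nonpos {N : ℕ} (hN : 1 ≤ N) {lam Lam : ℝ} (hlam : 0 ≤ lam) {x y : ℝ}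
    (hx : x ≤ 0) (hy : y ≤ 0) : Pplus N lam Lam x y ≤ 0 := by
  have hN' : (0 : ℝ) ≤ (N : ℝ) - 1 := by
    have : (1 : ℝ) ≤ N := by exact_mod_cast hN
    linarith
  have : 0 ≤ lam * (max (-x) 0 + ((N : ℝ) - 1) * max (-y) 0) := by positivity
  simp only [Pplus, max_eq_right hx, max_eq_right hy]
  linarith

/-- Differences of radial `C²` functions are radial `C²` functions. -/
theorem RadC2.sub {e R : ℝ} {u u' u'' v v' v'' : ℝ → ℝ} (hu : RadC2 e R u u' u'')
    (hv : RadC2 e R v v' v'') :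
    RadC2 e R (fun r => u r - v r) (fun r => u' r - v' r) (fun r => u'' r - v'' r) :=
  ⟨fun r hr => (hu.1 r hr).sub (hv.1 r hr), hu.2.1.sub hv.2.1,
    fun r hr => (hu.2.2.1 r hr).sub (hv.2.2.1 r hr), hu.2.2.2.sub hv.2.2.2⟩

/-- Maximum principle for radial subsolutions of the Pucci maximal operator with a first order
term and a zeroth order term `g` that is negative wherever the subsolution is positive. -/
theorem RadC2.nonpos_of_Pplus_nonneg {N : ℕ} (hN : 1 ≤ N) {R lam Lam gam : ℝ} (hR : 0 < R)
    (hlam : 0 ≤ lam) {w w' w'' g : ℝ → ℝ} (hw : RadC2 0 R w w' w'')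
    (hg : ContinuousOn g (Icc 0 R)) (hneg : ∀ r ∈ Icc (0 : ℝ) R, 0 < w r → g r < 0)
    (hineq : ∀ r ∈ Ioo (0 : ℝ) R,
      0 ≤ Pplus N lam Lam (w'' r) (w' r / r) + gam * |w' r| + g r)
    (hw0 : w' 0 = 0) (hwR : w R ≤ 0) : ∀ r ∈ Icc (0 : ℝ) R, w r ≤ 0 := by
  obtain ⟨hd, hc', hd', -⟩ := hw
  have hc : ContinuousOn w (Icc 0 R) := fun r hr => (hd r hr).continuousWithinAt
  have hda : ∀ r ∈ Ioo (0 : ℝ) R, HasDerivAt w (w' r) r := fun r hr =>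
    (hd r (Ioo_subset_Icc_self hr)).hasDerivAt (Icc_mem_nhds hr.1 hr.2)
  obtain ⟨a, ha, hmax⟩ := isCompact_Icc.exists_isMaxOn (nonempty_Icc.2 hR.le) hc
  by_contra! hpos
  obtain ⟨b, hb, hwb⟩ := hpos
  have hwa : 0 < w a := hwb.trans_le (hmax hb)
  have haR : a < R := lt_of_le_of_ne ha.2 (by rintro rfl; linarith)
  have hw'a : w' a = 0 := by
    rcases ha.1.eq_or_lt with h | h
    · rw [← h, hw0]
    · exact (hmax.isLocalMax (Icc_mem_nhds h haR)).hasDerivAt_eq_zero (hda a ⟨h, haR⟩)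
  have hev : ∀ᶠ r in 𝓝[Icc 0 R] a, gam * |w' r| + g r < 0 := by
    have hcont : ContinuousOn (fun r => gam * |w' r| + g r) (Icc 0 R) :=
      (continuousOn_const.mul hc'.abs).add hg
    refine (hcont a ha).eventually_lt_const ?_
    simpa [hw'a] using hneg a ha hwa
  obtain ⟨c, hac, hcR, hP⟩ : ∃ c, a < c ∧ c < R ∧
      ∀ r ∈ Ioc a c, 0 < Pplus N lam Lam (w'' r) (w' r / r) := by
    have hsub : 𝓝[>] a ≤ 𝓝[Icc 0 R] a := by
      rw [← nhdsWithin_Ioo_eq_nhdsGT haR]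
      exact nhdsWithin_mono a fun r hr => ⟨ha.1.trans hr.1.le, hr.2.le⟩
    obtain ⟨d, had, hd⟩ := mem_nhdsGT_iff_exists_Ioo_subset.1 (hsub hev)
    obtain ⟨c, hc1, hc2⟩ := exists_between (lt_min (mem_Ioi.1 had) haR)
    refine ⟨c, hc1, hc2.trans_le (min_le_right _ _), fun r hr => ?_⟩
    have h1 : gam * |w' r| + g r < 0 :=
      hd ⟨hr.1, hr.2.trans_lt (hc2.trans_le (min_le_left _ _))⟩
    have h2 := hineq r
      ⟨ha.1.trans_lt hr.1, hr.2.trans_lt (hc2.trans_le (min_le_right _ _))⟩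
    linarith
  have hsubI : Icc a c ⊆ Icc 0 R := Icc_subset_Icc ha.1 hcR.le
  have hsubO : Ioc a c ⊆ Ioo 0 R := fun r hr => ⟨ha.1.trans_lt hr.1, hr.2.trans_lt hcR⟩
  have hw'nonneg : ∀ r ∈ Icc a c, 0 ≤ w' r := by
    obtain ⟨s, hs, hmin⟩ :=
      isCompact_Icc.exists_isMinOn (nonempty_Icc.2 hac.le) (hc'.mono hsubI)
    refine fun r hr => le_trans ?_ (hmin hr)
    by_contra! hlt
    have has : a < s := lt_of_le_of_ne hs.1 (by rintro rfl; linarith)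
    have hs' : s ∈ Ioo 0 R := hsubO ⟨has, hs.2⟩
    have hw''s : w'' s ≤ 0 := (hd' s hs').nonpos_of_forall_le_left has
      fun y hy => hmin ⟨hy.1.le, hy.2.le.trans hs.2⟩
    exact absurd (hP s ⟨has, hs.2⟩)
      (Pplus_nonpos hN hlam hw''s (div_nonpos_of_nonpos_of_nonneg hlt.le hs'.1.le)).not_gt
  have hmono : MonotoneOn w (Icc a c) := by
    refine monotoneOn_of_hasDerivWithinAt_nonneg (f' := w') (convex_Icc a c) (hc.mono hsubI) ?_ ?_
    · intro r hr
      rw [interior_Icc] at hr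
      exact (hda r (hsubO (Ioo_subset_Ioc_self hr))).hasDerivWithinAt
    · intro r hr
      exact hw'nonneg r (interior_subset hr)
  have hw'zero : ∀ r ∈ Ioo a c, w' r = 0 := by
    intro r hr
    have hconst : w =ᶠ[𝓝 r] fun _ => w a := by
      filter_upwards [Icc_mem_nhds hr.1 hr.2] with y hy
      exact le_antisymm (hmax (hsubI hy)) (hmono (left_mem_Icc.2 hac.le) hy hy.1)
    exact (hda r (hsubO (Ioo_subset_Ioc_self hr))).unique
      ((hasDerivAt_const r (w a)).congr_of_eventuallyEq hconst)
  obtain ⟨r, hr⟩ := exists_between hac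
  have hr' : r ∈ Ioo a c := hr
  have hw''r : w'' r = 0 := by
    have hzero : w' =ᶠ[𝓝 r] fun _ => (0 : ℝ) := by
      filter_upwards [Ioo_mem_nhds hr.1 hr.2] with y hy
      exact hw'zero y hy
    exact (hd' r (hsubO (Ioo_subset_Ioc_self hr'))).unique
      ((hasDerivAt_const r (0 : ℝ)).congr_of_eventuallyEq hzero)
  exact absurd (hP r (Ioo_subset_Ioc_self hr'))
    (Pplus_nonpos hN hlam hw''r.le (by rw [hw'zero r hr', zero_div])).not_gt

/-- the radial comparison principle. -/
theorem stmt_14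
    (N : ℕ) (hN : 1 ≤ N) (R lam Lam gam del : ℝ) (hR : 0 < R)
    (hlam : 0 < lam) (hLam : lam ≤ Lam) (hgam : 0 < gam) (hdel : 0 < del)
    (FF : ℝ → ℝ → ℝ → ℝ → ℝ → ℝ)
    (hFcont : ContinuousOn
      (fun z : ℝ × ℝ × ℝ × ℝ × ℝ => FF z.1 z.2.1 z.2.2.1 z.2.2.2.1 z.2.2.2.2)
      {z : ℝ × ℝ × ℝ × ℝ × ℝ | z.2.2.2.2 ∈ Icc 0 R})
    (hF1 : ∀ s : ℝ, 0 ≤ s → ∀ m l p u : ℝ, ∀ r ∈ Icc (0 : ℝ) R,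
      FF (s * m) (s * l) (s * p) (s * u) r = s * FF m l p u r)
    (hF2 : ∀ m l p u m' l' p' u' : ℝ, ∀ r ∈ Icc (0 : ℝ) R,
      Pminus N lam Lam (m - m') (l - l') - gam * |p - p'| - del * |u - u'|
          ≤ FF m l p u r - FF m' l' p' u' r ∧
        FF m l p u r - FF m' l' p' u' r
          ≤ Pplus N lam Lam (m - m') (l - l') + gam * |p - p'| + del * |u - u'|)
    (hF3 : ∀ m l p u m' l' p' u' : ℝ, ∀ r ∈ Icc (0 : ℝ) R,
      -FF (m' - m) (l' - l) (p' - p) (u' - u) r ≤ FF m l p u r - FF m' l' p' u' r ∧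
        FF m l p u r - FF m' l' p' u' r ≤ FF (m - m') (l - l') (p - p') (u - u') r)
    (hdec : ∀ m l p : ℝ, ∀ r ∈ Icc (0 : ℝ) R, StrictAnti fun u => FF m l p u r)
    (u u' u'' v v' v'' : ℝ → ℝ)
    (hu : RadC2 0 R u u' u'') (hv : RadC2 0 R v v' v'')
    (hcomp : ∀ r ∈ Ioo (0 : ℝ) R,
      FF (v'' r) (v' r / r) (v' r) (v r) r ≤ FF (u'' r) (u' r / r) (u' r) (u r) r)
    (hbR : u R = v R) (hu0 : u' 0 = 0) (hv0 : v' 0 = 0) :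
    ∀ r ∈ Icc (0 : ℝ) R, u r ≤ v r := by
  have hw := hu.sub hv
  have hzero : ∀ r ∈ Icc (0 : ℝ) R, FF 0 0 0 0 r = 0 := fun r hr => by
    simpa using hF1 0 le_rfl 0 0 0 0 r hr
  have hc : ContinuousOn (fun r => u r - v r) (Icc 0 R) :=
    fun r hr => (hw.1 r hr).continuousWithinAt
  have hg : ContinuousOn (fun r => FF 0 0 0 (u r - v r) r) (Icc 0 R) :=
    hFcont.comp (f := fun r => ((0 : ℝ), (0 : ℝ), (0 : ℝ), u r - v r, r))
      (continuousOn_const.prodMk (continuousOn_const.prodMk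
        (continuousOn_const.prodMk (hc.prodMk continuousOn_id)))) fun r hr => hr
  have key := hw.nonpos_of_Pplus_nonneg hN (Lam := Lam) (gam := gam) hR hlam.le hg
    (fun r hr hpos => (hdec 0 0 0 r hr hpos).trans_eq (hzero r hr)) (fun r hr => ?_)
    (by simp [hu0, hv0]) (by simp [hbR])
  · exact fun r hr => sub_nonpos.1 (key r hr)
  · have hr' := Ioo_subset_Icc_self hr
    have h1 := (hF3 (u'' r) (u' r / r) (u' r) (u r) (v'' r) (v' r / r) (v' r) (v r) r hr').2
    have h2 := (hF2 (u'' r - v'' r) (u' r / r - v' r / r) (u' r - v' r) (u r - v r)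
      0 0 0 (u r - v r) r hr').2
    simp only [sub_zero, sub_self, abs_zero, mul_zero, add_zero] at h2
    have h3 := hcomp r hr
    rw [sub_div]
    linarith
end

section
/- Assume 𝓕 satisfies (F1), (F2) and (F3). Then there exists κ > 0 such that for every continuous f : [0,R] → ℝ the radial Dirichlet problem 𝓕(u''(r), u'(r)/r, u'(r), u(r), r) − κ·u(r) = f(r) for r ∈ (0,R), with u'(0) = 0 and u(R) = 0, has a unique solution u ∈ C²(0,R) ∩ C¹([0,R]). -/
open Set

/-- The weighted average `∫₀¹ σ^K h(rσ) dσ`; `w(r) = r * radAvg K h r` solves `w' + K w / r = h`. -/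
noncomputable def radAvg (K : ℕ) (h : ℝ → ℝ) (r : ℝ) : ℝ :=
  ∫ σ in (0 : ℝ)..1, σ ^ K * h (r * σ)

lemma continuous_radAvg (K : ℕ) {h : ℝ → ℝ} (hh : Continuous h) : Continuous (radAvg K h) := by
  unfold radAvg
  apply intervalIntegral.continuous_parametric_intervalIntegral_of_continuous'
  fun_prop

lemma radAvg_sub (K : ℕ) {h₁ h₂ : ℝ → ℝ} (hh₁ : Continuous h₁) (hh₂ : Continuous h₂) (r : ℝ) :
    radAvg K h₁ r - radAvg K h₂ r = radAvg K (fun s => h₁ s - h₂ s) r := by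
  unfold radAvg
  rw [← intervalIntegral.integral_sub]
  · congr 1; ext σ; ring
  · exact Continuous.intervalIntegrable (by fun_prop) _ _
  · exact Continuous.intervalIntegrable (by fun_prop) _ _

lemma pow_succ_mul_radAvg (K : ℕ) (h : ℝ → ℝ) (r : ℝ) :
    r ^ (K + 1) * radAvg K h r = ∫ s in (0 : ℝ)..r, s ^ K * h s := by
  have := intervalIntegral.mul_integral_comp_mul_left (a := 0) (b := 1)
    (f := fun s => s ^ K * h s) (c := r)
  rw [mul_zero, mul_one] at this
  rw [← this, radAvg, pow_succ', mul_assoc, ← intervalIntegral.integral_const_mul]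
  congr 2
  ext σ
  ring

lemma hasDerivAt_mul_radAvg (K : ℕ) {h : ℝ → ℝ} (hh : Continuous h) {r : ℝ} (hr : 0 < r) :
    HasDerivAt (fun s => s * radAvg K h s) (h r - K * radAvg K h r) r := by
  have hI : HasDerivAt (fun t => ∫ s in (0 : ℝ)..t, s ^ K * h s) (r ^ K * h r) r :=
    intervalIntegral.integral_hasDerivAt_right
      (Continuous.intervalIntegrable (by fun_prop) _ _)
      (Continuous.stronglyMeasurableAtFilter (by fun_prop) _ _)
      (Continuous.continuousAt (by fun_prop))
  have hd := hI.div (hasDerivAt_pow K r) (pow_pos hr K).ne'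
  have he : (fun s => s * radAvg K h s) =ᶠ[nhds r]
      ((fun t => ∫ s in (0 : ℝ)..t, s ^ K * h s) / fun t => t ^ K) := by
    filter_upwards [lt_mem_nhds hr] with s hs
    simp only [Pi.div_apply]
    rw [← pow_succ_mul_radAvg, pow_succ]
    field_simp
  refine (hd.congr_of_eventuallyEq he).congr_deriv ?_
  rw [← pow_succ_mul_radAvg]
  rcases K with _ | K
  · simp
  · simp only [Nat.add_sub_cancel]
    field_simp
    ring

lemma integral_exp_mul_le {M : ℝ} (hM : 0 < M) (r : ℝ) :
    ∫ s in (0 : ℝ)..r, Real.exp (M * s) ≤ Real.exp (M * r) / M := by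
  have h := intervalIntegral.integral_comp_mul_left (a := 0) (b := r) Real.exp hM.ne'
  rw [h, integral_exp]
  simp only [mul_zero, Real.exp_zero, smul_eq_mul]
  rw [inv_mul_eq_div]
  gcongr
  linarith

lemma abs_radAvg_le (K : ℕ) {h : ℝ → ℝ} {M D r : ℝ} (hM : 0 ≤ M)
    (hD : 0 ≤ D) (hr : 0 ≤ r) (hb : ∀ s ∈ Icc 0 r, |h s| ≤ D * Real.exp (M * s)) :
    |radAvg K h r| ≤ D * Real.exp (M * r) / (K + 1) := by
  have h1 : |radAvg K h r| ≤ ∫ σ in (0 : ℝ)..1, σ ^ K * (D * Real.exp (M * r)) := by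
    unfold radAvg
    rw [← Real.norm_eq_abs]
    refine intervalIntegral.norm_integral_le_of_norm_le zero_le_one ?_
      (Continuous.intervalIntegrable (by fun_prop) _ _)
    refine Filter.Eventually.of_forall fun σ hσ => ?_
    rw [Real.norm_eq_abs, abs_mul, abs_of_nonneg (pow_nonneg hσ.1.le K)]
    have hle : r * σ ≤ r := mul_le_of_le_one_right hr hσ.2
    refine mul_le_mul_of_nonneg_left ?_ (pow_nonneg hσ.1.le K)
    refine (hb (r * σ) ⟨mul_nonneg hr hσ.1.le, hle⟩).trans ?_
    gcongr
  refine h1.trans (le_of_eq ?_)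
  rw [intervalIntegral.integral_mul_const, integral_pow]
  simp
  ring

lemma abs_mul_radAvg_le (K : ℕ) {h : ℝ → ℝ} {M D r : ℝ} (hM : 0 < M)
    (hD : 0 ≤ D) (hr : 0 ≤ r) (hb : ∀ s ∈ Icc 0 r, |h s| ≤ D * Real.exp (M * s)) :
    |r * radAvg K h r| ≤ D * Real.exp (M * r) / M := by
  have h1 : |radAvg K h r| ≤ ∫ σ in (0 : ℝ)..1, D * Real.exp (M * (r * σ)) := by
    unfold radAvg
    rw [← Real.norm_eq_abs]
    refine intervalIntegral.norm_integral_le_of_norm_le zero_le_one ?_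
      (Continuous.intervalIntegrable (by fun_prop) _ _)
    refine Filter.Eventually.of_forall fun σ hσ => ?_
    rw [Real.norm_eq_abs, abs_mul, abs_of_nonneg (pow_nonneg hσ.1.le K)]
    have hle : r * σ ≤ r := mul_le_of_le_one_right hr hσ.2
    refine (mul_le_of_le_one_left (abs_nonneg _) (pow_le_one₀ hσ.1.le hσ.2)).trans ?_
    exact hb (r * σ) ⟨mul_nonneg hr hσ.1.le, hle⟩
  have h2 := intervalIntegral.mul_integral_comp_mul_left (a := 0) (b := 1)
    (f := fun s => Real.exp (M * s)) (c := r)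
  rw [mul_zero, mul_one] at h2
  rw [intervalIntegral.integral_const_mul] at h1
  rw [abs_mul, abs_of_nonneg hr]
  calc r * |radAvg K h r| ≤ r * (D * ∫ σ in (0 : ℝ)..1, Real.exp (M * (r * σ))) := by gcongr
    _ = D * ∫ s in (0 : ℝ)..r, Real.exp (M * s) := by rw [← h2]; ring
    _ ≤ D * (Real.exp (M * r) / M) := by gcongr; exact integral_exp_mul_le hM r
    _ = _ := by ring

/-- The function with value `a` at `0` and derivative `r * radAvg K h r`. -/
noncomputable def radPrimitive (K : ℕ) (a : ℝ) (h : ℝ → ℝ) (r : ℝ) : ℝ :=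
  a + ∫ s in (0 : ℝ)..r, s * radAvg K h s

lemma hasDerivAt_radPrimitive (K : ℕ) (a : ℝ) {h : ℝ → ℝ} (hh : Continuous h) (r : ℝ) :
    HasDerivAt (radPrimitive K a h) (r * radAvg K h r) r := by
  have hc : Continuous (fun s => s * radAvg K h s) := continuous_id.mul (continuous_radAvg K hh)
  exact (intervalIntegral.integral_hasDerivAt_right (hc.intervalIntegrable _ _)
    (hc.stronglyMeasurableAtFilter _ _) hc.continuousAt).const_add a

lemma continuous_radPrimitive (K : ℕ) (a : ℝ) {h : ℝ → ℝ} (hh : Continuous h) :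
    Continuous (radPrimitive K a h) :=
  continuous_iff_continuousAt.2 fun r => (hasDerivAt_radPrimitive K a hh r).continuousAt

lemma abs_radPrimitive_sub_le (K : ℕ) (a b : ℝ) {h₁ h₂ : ℝ → ℝ} (hh₁ : Continuous h₁)
    (hh₂ : Continuous h₂) {M D r : ℝ} (hM : 1 ≤ M) (hD : 0 ≤ D) (hr : 0 ≤ r)
    (hb : ∀ s ∈ Icc 0 r, |h₁ s - h₂ s| ≤ D * Real.exp (M * s)) :
    |radPrimitive K a h₁ r - radPrimitive K b h₂ r| ≤ |a - b| + D * Real.exp (M * r) / M := by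
  have hM0 : 0 < M := by linarith
  have hc : ∀ {h : ℝ → ℝ}, Continuous h → Continuous (fun s => s * radAvg K h s) :=
    fun hh => continuous_id.mul (continuous_radAvg K hh)
  have e : radPrimitive K a h₁ r - radPrimitive K b h₂ r =
      (a - b) + ∫ s in (0 : ℝ)..r, s * radAvg K (fun s => h₁ s - h₂ s) s := by
    unfold radPrimitive
    rw [add_sub_add_comm, ← intervalIntegral.integral_sub ((hc hh₁).intervalIntegrable _ _)
      ((hc hh₂).intervalIntegrable _ _)]
    congr 2
    ext s
    rw [← mul_sub, radAvg_sub K hh₁ hh₂]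
  rw [e]
  refine (abs_add_le _ _).trans (add_le_add le_rfl ?_)
  calc |∫ s in (0 : ℝ)..r, s * radAvg K (fun s => h₁ s - h₂ s) s|
      ≤ ∫ s in (0 : ℝ)..r, D * Real.exp (M * s) := by
        rw [← Real.norm_eq_abs]
        refine intervalIntegral.norm_integral_le_of_norm_le hr ?_
          (Continuous.intervalIntegrable (by fun_prop) _ _)
        refine Filter.Eventually.of_forall fun s hs => ?_
        rw [Real.norm_eq_abs]
        refine (abs_mul_radAvg_le K hM0 hD hs.1.le
          fun t ht => hb t ⟨ht.1, ht.2.trans hs.2⟩).trans ?_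
        exact div_le_self (by positivity) hM
    _ = D * ∫ s in (0 : ℝ)..r, Real.exp (M * s) := intervalIntegral.integral_const_mul _ _
    _ ≤ D * (Real.exp (M * r) / M) := by gcongr; exact integral_exp_mul_le hM0 r
    _ = _ := by ring

/-- Banach's fixed point theorem in the weighted norm `sup |h r| e^{-M r}`, together with Lipschitz
dependence on a parameter. -/
lemma exists_fixedPoint_weighted {R M q C : ℝ} (hR : 0 ≤ R) (hM : 0 ≤ M) (hq : 0 ≤ q)
    (hq1 : q < 1) (hC : 0 ≤ C) (Φ : ℝ → (ℝ → ℝ) → ℝ → ℝ)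
    (hc : ∀ a h, Continuous h → Continuous (Φ a h))
    (hlip : ∀ a b h₁ h₂ D, Continuous h₁ → Continuous h₂ → 0 ≤ D →
      (∀ r ∈ Icc 0 R, |h₁ r - h₂ r| ≤ D * Real.exp (M * r)) →
      ∀ r ∈ Icc 0 R, |Φ a h₁ r - Φ b h₂ r| ≤ q * D * Real.exp (M * r) + C * |a - b|) :
    ∃ H : ℝ → ℝ → ℝ, (∀ a, Continuous (H a)) ∧ (∀ a, ∀ r ∈ Icc 0 R, Φ a (H a) r = H a r) ∧
      ∀ a b, ∀ r ∈ Icc 0 R, |H a r - H b r| ≤ C / (1 - q) * |a - b| * Real.exp (M * r) := by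
  let E : C(Icc (0 : ℝ) R, ℝ) → ℝ → ℝ := fun g r => Real.exp (M * r) * IccExtend hR g r
  have hE : ∀ g, Continuous (E g) := fun g =>
    (by fun_prop : Continuous fun r => Real.exp (M * r)).mul g.continuous.Icc_extend'
  have hEv : ∀ g (r : Icc (0 : ℝ) R), E g r = Real.exp (M * r) * g r := fun g r => by
    simp only [E, IccExtend_val]
  have hEd : ∀ g₁ g₂, ∀ r ∈ Icc 0 R, |E g₁ r - E g₂ r| ≤ dist g₁ g₂ * Real.exp (M * r) := by
    intro g₁ g₂ r hr
    rw [hEv g₁ ⟨r, hr⟩, hEv g₂ ⟨r, hr⟩, ← mul_sub, abs_mul, abs_of_pos (Real.exp_pos _), mul_comm]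
    have := ContinuousMap.dist_apply_le_dist (f := g₁) (g := g₂) ⟨r, hr⟩
    rw [Real.dist_eq] at this
    gcongr
  let T : ℝ → C(Icc (0 : ℝ) R, ℝ) → C(Icc (0 : ℝ) R, ℝ) := fun a g =>
    ⟨fun r => Real.exp (-(M * r)) * Φ a (E g) r, by
      have := hc a (E g) (hE g)
      fun_prop⟩
  have hT : ∀ a b g₁ g₂, dist (T a g₁) (T b g₂) ≤ q * dist g₁ g₂ + C * |a - b| := by
    intro a b g₁ g₂
    have h0 : 0 ≤ q * dist g₁ g₂ + C * |a - b| := by positivity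
    refine (ContinuousMap.dist_le h0).2 fun r => ?_
    have h := hlip a b (E g₁) (E g₂) _ (hE _) (hE _) dist_nonneg (hEd g₁ g₂) r r.2
    have hx : Real.exp (-(M * r)) * Real.exp (M * r) = 1 := by
      rw [← Real.exp_add]; simp
    have hx1 : Real.exp (-(M * r)) ≤ 1 :=
      Real.exp_le_one_iff.2 (neg_nonpos.2 (mul_nonneg hM r.2.1))
    calc dist (T a g₁ r) (T b g₂ r)
        = Real.exp (-(M * r)) * |Φ a (E g₁) r - Φ b (E g₂) r| := by
          simp only [T, ContinuousMap.coe_mk]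
          rw [Real.dist_eq, ← mul_sub, abs_mul, abs_of_pos (Real.exp_pos _)]
      _ ≤ Real.exp (-(M * r)) * (q * dist g₁ g₂ * Real.exp (M * r) + C * |a - b|) := by gcongr
      _ = q * dist g₁ g₂ * (Real.exp (-(M * r)) * Real.exp (M * r))
          + Real.exp (-(M * r)) * (C * |a - b|) := by ring
      _ ≤ q * dist g₁ g₂ * 1 + 1 * (C * |a - b|) := by rw [hx]; gcongr
      _ = _ := by ring
  have hcon : ∀ a, ContractingWith ⟨q, hq⟩ (T a) := fun a =>
    ⟨by exact_mod_cast hq1, LipschitzWith.of_dist_le_mul fun g₁ g₂ => by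
      have h := hT a a g₁ g₂
      rw [sub_self, abs_zero, mul_zero, add_zero] at h
      exact h⟩
  let G : ℝ → C(Icc (0 : ℝ) R, ℝ) := fun a => (hcon a).fixedPoint
  have hG : ∀ a, T a (G a) = G a := fun a => (hcon a).fixedPoint_isFixedPt
  refine ⟨fun a => E (G a), fun a => hE _, fun a r hr => ?_, fun a b r hr => ?_⟩
  · have h := DFunLike.congr_fun (hG a) ⟨r, hr⟩
    refine Eq.trans ?_ (hEv (G a) ⟨r, hr⟩).symm
    rw [← h]
    simp only [T, ContinuousMap.coe_mk]
    rw [← mul_assoc, ← Real.exp_add]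
    simp
  · have h := hT a b (G a) (G b)
    rw [hG, hG] at h
    have hd : dist (G a) (G b) ≤ C / (1 - q) * |a - b| := by
      rw [div_mul_eq_mul_div, le_div_iff₀ (by linarith)]
      linarith
    refine (hEd _ _ r hr).trans ?_
    gcongr

/-- If `w'` starts at `0`, and `w'' > C w'` as long as `w > 0` and `w' ≤ 0`, then a positive `w`
stays above its initial value. -/
lemma le_of_second_deriv_gt {t₀ R C : ℝ} {w w' w'' : ℝ → ℝ}
    (h1 : ∀ r ∈ Icc t₀ R, HasDerivWithinAt w (w' r) (Icc t₀ R) r)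
    (h2 : ContinuousOn w' (Icc t₀ R)) (h3 : ∀ r ∈ Ioo t₀ R, HasDerivAt w' (w'' r) r)
    (h0 : 0 < w t₀) (h0' : w' t₀ = 0)
    (hgt : ∀ r ∈ Ioo t₀ R, 0 < w r → w' r ≤ 0 → C * w' r < w'' r)
    {t : ℝ} (ht : t ∈ Icc t₀ R) : w t₀ ≤ w t := by
  by_contra! hlt
  have hwc : ContinuousOn w (Icc t₀ R) := fun r hr => (h1 r hr).continuousWithinAt
  set c := max (w t) (w t₀ / 2) with hc
  have hcpos : 0 < c := lt_max_of_lt_right (by linarith)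
  have hclt : c < w t₀ := max_lt hlt (by linarith)
  have hcomp : IsCompact (Icc t₀ t ∩ w ⁻¹' Iic c) :=
    isCompact_Icc.of_isClosed_subset
      ((hwc.mono (Icc_subset_Icc_right ht.2)).preimage_isClosed_of_isClosed isClosed_Icc
        isClosed_Iic) inter_subset_left
  obtain ⟨τ, ⟨hτ, hτc⟩, hmin⟩ := hcomp.exists_isLeast
    ⟨t, ⟨ht.1, le_rfl⟩, le_max_left (w t) (w t₀ / 2)⟩
  have hτc : w τ ≤ c := hτc
  have hτ0 : t₀ < τ := lt_of_le_of_ne hτ.1 (by rintro rfl; linarith)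
  have hpos : ∀ s ∈ Ico t₀ τ, 0 < w s := by
    intro s hs
    by_contra! hle
    exact absurd (hmin ⟨⟨hs.1, hs.2.le.trans hτ.2⟩, hle.trans hcpos.le⟩) (not_le.2 hs.2)
  have hτR : τ ≤ R := hτ.2.trans ht.2
  obtain ⟨ξ, hξ, hξe⟩ := exists_hasDerivAt_eq_slope w w' hτ0
    (hwc.mono (Icc_subset_Icc_right hτR)) fun x hx =>
      (h1 x ⟨hx.1.le, hx.2.le.trans hτR⟩).hasDerivAt (Icc_mem_nhds hx.1 (hx.2.trans_le hτR))
  have hξn : w' ξ < 0 := by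
    rw [hξe]
    exact div_neg_of_neg_of_pos (by linarith) (by linarith)
  have hξR : ξ < R := hξ.2.trans_le hτR
  set z : ℝ → ℝ := fun r => Real.exp (-(C * r)) * w' r with hz
  have hzc : ContinuousOn z (Icc t₀ ξ) :=
    (by fun_prop : Continuous fun r => Real.exp (-(C * r))).continuousOn.mul
      (h2.mono (Icc_subset_Icc_right hξR.le))
  obtain ⟨p, hp, hpmin⟩ := isCompact_Icc.exists_isMinOn (nonempty_Icc.2 hξ.1.le) hzc
  have hzp : z p < 0 := lt_of_le_of_lt (hpmin ⟨hξ.1.le, le_rfl⟩)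
    (mul_neg_of_pos_of_neg (Real.exp_pos _) hξn)
  have hwp : w' p < 0 := by
    by_contra! hle
    exact absurd (mul_nonneg (Real.exp_pos (-(C * p))).le hle) (not_le.2 hzp)
  have hp0 : t₀ < p := lt_of_le_of_ne hp.1 (by rintro rfl; linarith)
  have hpR : p ∈ Ioo t₀ R := ⟨hp0, hp.2.trans_lt hξR⟩
  have hzd : HasDerivAt z (Real.exp (-(C * p)) * (w'' p - C * w' p)) p := by
    have he : HasDerivAt (fun r => Real.exp (-(C * r))) (Real.exp (-(C * p)) * (-(C * 1))) p :=
      (((hasDerivAt_id p).const_mul C).neg).exp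
    exact (he.mul (h3 p hpR)).congr_deriv (by ring)
  have hzpos : 0 < Real.exp (-(C * p)) * (w'' p - C * w' p) :=
    mul_pos (Real.exp_pos _)
      (sub_pos.2 (hgt p hpR (hpos p ⟨hp.1, hp.2.trans_lt hξ.2⟩) hwp.le))
  have hsl := (hasDerivWithinAt_iff_tendsto_slope' (s := Iio p) (by simp)).1
    hzd.hasDerivWithinAt
  have hev := hsl.eventually (lt_mem_nhds hzpos)
  obtain ⟨s, hs, hsp⟩ := (hev.and (Ioo_mem_nhdsLT hp0)).exists
  rw [slope_def_field] at hs
  have hle : z p ≤ z s := hpmin ⟨hsp.1.le, hsp.2.le.trans hp.2⟩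
  exact absurd hs (not_lt.2 (div_nonpos_of_nonneg_of_nonpos (by linarith) (by linarith [hsp.2])))

lemma lt_of_lt_Pplus {N : ℕ} (hN : 1 ≤ N) {lam Lam gam w x y p : ℝ} (hlam : 0 < lam)
    (hgam : 0 < gam) (hw : 0 < w) (hy : y ≤ 0) (hp : p ≤ 0)
    (h : w ≤ Pplus N lam Lam x y + gam * |p|) : gam / lam * p < x := by
  have hN' : (0 : ℝ) ≤ (N : ℝ) - 1 := by
    have : (1 : ℝ) ≤ N := by exact_mod_cast hN
    linarith
  unfold Pplus at h
  rw [max_eq_right hy, max_eq_left (neg_nonneg.2 hy), abs_of_nonpos hp] at h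
  have hyn := mul_nonneg hlam.le (mul_nonneg hN' (neg_nonneg.2 hy))
  rw [div_mul_eq_mul_div, div_lt_iff₀ hlam]
  have hgp : gam * p ≤ 0 := mul_nonpos_of_nonneg_of_nonpos hgam.le hp
  rcases lt_or_ge 0 x with hx | hx
  · have := mul_pos hx hlam
    linarith
  · rw [max_eq_right hx, max_eq_left (neg_nonneg.2 hx)] at h
    linarith

lemma abs_sub_le_of_Pucci {N K : ℕ} (hN : 1 ≤ N) {lam Lam x y d e D : ℝ} (hlam : 0 < lam)
    (hLam : lam ≤ Lam) (hK : ((N : ℝ) - 1) * Lam ≤ K * lam) (hx : |x| ≤ D)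
    (hy : |y| ≤ D / (K + 1))
    (h₁ : Pminus N lam Lam (x - K * y) y - e ≤ d) (h₂ : d ≤ Pplus N lam Lam (x - K * y) y + e) :
    |Lam * x - d| ≤ (Lam - lam / (K + 1)) * D + e := by
  have hN' : (0 : ℝ) ≤ (N : ℝ) - 1 := by
    have : (1 : ℝ) ≤ N := by exact_mod_cast hN
    linarith
  have hK0 : (0 : ℝ) ≤ K := K.cast_nonneg
  have hK1 : (0 : ℝ) < (K : ℝ) + 1 := by linarith
  have hD : 0 ≤ D := (abs_nonneg x).trans hx
  set Y := D / ((K : ℝ) + 1) with hY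
  have hY0 : 0 ≤ Y := div_nonneg hD hK1.le
  have hDY : D = (K + 1) * Y := by rw [hY]; field_simp
  have hrhs : (Lam - lam / (K + 1)) * D = Lam * D - lam * Y := by rw [hY]; ring
  rw [hrhs]
  have key : ∀ α β : ℝ, lam ≤ α → α ≤ Lam → 0 ≤ β → β ≤ Lam →
      |Lam * x - (α * (x - K * y) + ((N : ℝ) - 1) * (β * y))| ≤ Lam * D - lam * Y := by
    intro α β hα hα' hβ hβ'
    have hc0 : 0 ≤ α * K - ((N : ℝ) - 1) * β := by
      have := mul_le_mul_of_nonneg_left hβ' hN'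
      have := mul_le_mul_of_nonneg_right hα hK0
      linarith
    have hc1 : α * K - ((N : ℝ) - 1) * β ≤ α * K := by
      have := mul_nonneg hN' hβ
      linarith
    calc |Lam * x - (α * (x - K * y) + ((N : ℝ) - 1) * (β * y))|
        = |(Lam - α) * x + (α * K - ((N : ℝ) - 1) * β) * y| := by congr 1; ring
      _ ≤ |(Lam - α) * x| + |(α * K - ((N : ℝ) - 1) * β) * y| := abs_add_le _ _
      _ = (Lam - α) * |x| + (α * K - ((N : ℝ) - 1) * β) * |y| := by
          rw [abs_mul, abs_mul, abs_of_nonneg (sub_nonneg.2 hα'), abs_of_nonneg hc0]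
      _ ≤ (Lam - α) * D + (α * K) * Y := by gcongr; linarith
      _ = Lam * D - α * Y := by rw [hDY]; ring
      _ ≤ Lam * D - lam * Y := by gcongr
  have hLam0 : 0 ≤ Lam := by linarith
  have key₁ := key lam lam le_rfl hLam hlam.le hLam
  have key₂ := key lam Lam le_rfl hLam hLam0 le_rfl
  have key₃ := key Lam lam hLam le_rfl hlam.le hLam
  have key₄ := key Lam Lam hLam le_rfl hLam0 le_rfl
  rw [abs_le] at key₁ key₂ key₃ key₄ ⊢
  unfold Pminus at h₁
  unfold Pplus at h₂
  rcases le_total 0 (x - K * y) with hm | hm <;> rcases le_total 0 y with hl | hl <;>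
    simp only [max_eq_left, max_eq_right, hm, hl, neg_nonneg, neg_nonpos] at h₁ h₂ <;>
    constructor <;> linarith

section RadialOperator

variable {N : ℕ} {R lam Lam gam del : ℝ} {FF : ℝ → ℝ → ℝ → ℝ → ℝ → ℝ}

/-- Solvability of the initial value problem `u(0) = a`, `u'(0) = 0`, with continuous dependence of
`u(R)` on `a`. -/
lemma exists_initialValue (hN : 1 ≤ N) (hR : 0 < R) (hlam : 0 < lam) (hLam : lam ≤ Lam)
    (hgam : 0 < gam) (hdel : 0 < del)
    (hFcont : ContinuousOn
      (fun z : ℝ × ℝ × ℝ × ℝ × ℝ => FF z.1 z.2.1 z.2.2.1 z.2.2.2.1 z.2.2.2.2)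
      {z : ℝ × ℝ × ℝ × ℝ × ℝ | z.2.2.2.2 ∈ Icc 0 R})
    (hF2 : ∀ m l p u m' l' p' u' : ℝ, ∀ r ∈ Icc (0 : ℝ) R,
      Pminus N lam Lam (m - m') (l - l') - gam * |p - p'| - del * |u - u'|
          ≤ FF m l p u r - FF m' l' p' u' r ∧
        FF m l p u r - FF m' l' p' u' r
          ≤ Pplus N lam Lam (m - m') (l - l') + gam * |p - p'| + del * |u - u'|)
    {κ : ℝ} (hκ : 0 ≤ κ) {f : ℝ → ℝ} (hf : ContinuousOn f (Icc 0 R)) :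
    ∃ u u' u'' : ℝ → ℝ → ℝ,
      (∀ a, RadC2 0 R (u a) (u' a) (u'' a) ∧
        (∀ r ∈ Ioo (0 : ℝ) R,
          FF (u'' a r) (u' a r / r) (u' a r) (u a r) r - κ * u a r = f r) ∧
        u' a 0 = 0 ∧ u a 0 = a) ∧
      Continuous fun a => u a R := by
  have hLam0 : 0 < Lam := hlam.trans_le hLam
  obtain ⟨K, hK⟩ := exists_nat_ge (((N : ℝ) - 1) * Lam / lam)
  rw [div_le_iff₀ hlam] at hK
  have hK1 : (0 : ℝ) < (K : ℝ) + 1 := by positivity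
  set θ := lam / (2 * ((K : ℝ) + 1)) with hθ
  have hθ0 : 0 < θ := by positivity
  have hθL : θ ≤ Lam := by
    rw [hθ, div_le_iff₀ (by positivity)]
    have := mul_nonneg hLam0.le (Nat.cast_nonneg (α := ℝ) K)
    linarith
  have hθ2 : lam / (K + 1) = 2 * θ := by rw [hθ]; field_simp
  set M := max 1 ((gam + del + κ) / θ) with hMdef
  have hM1 : 1 ≤ M := le_max_left _ _
  have hM0 : 0 < M := by linarith
  have hMθ : (gam + del + κ) / M ≤ θ := by
    rw [div_le_comm₀ hM0 hθ0]
    exact le_max_right _ _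
  let π : ℝ → ℝ := fun r => projIcc 0 R hR.le r
  have hπ : Continuous π := continuous_subtype_val.comp continuous_projIcc
  have hπR : ∀ r, π r ∈ Icc 0 R := fun r => (projIcc 0 R hR.le r).2
  have hπe : ∀ r ∈ Icc 0 R, π r = r := fun r hr => by simp only [π, projIcc_of_mem hR.le hr]
  have hfc : Continuous fun r => f (π r) := hf.comp_continuous hπ hπR
  let F : ℝ → (ℝ → ℝ) → ℝ → ℝ := fun a h r =>
    FF (h r - K * radAvg K h r) (radAvg K h r) (r * radAvg K h r) (radPrimitive K a h r) (π r)
  let Φ : ℝ → (ℝ → ℝ) → ℝ → ℝ := fun a h r =>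
    h r - (F a h r - κ * radPrimitive K a h r - f (π r)) / Lam
  have hF : ∀ a h, Continuous h → Continuous (F a h) := by
    intro a h hh
    have hA := continuous_radAvg K hh
    have hU := continuous_radPrimitive K a hh
    exact hFcont.comp_continuous
      (f := fun r => (h r - K * radAvg K h r, radAvg K h r, r * radAvg K h r,
        radPrimitive K a h r, π r)) (by fun_prop) hπR
  have hΦ : ∀ a h, Continuous h → Continuous (Φ a h) := by
    intro a h hh
    exact hh.sub ((((hF a h hh).sub (continuous_const.mul
      (continuous_radPrimitive K a hh))).sub hfc).div_const Lam)
  have hlip : ∀ a b h₁ h₂ D, Continuous h₁ → Continuous h₂ → 0 ≤ D →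
      (∀ r ∈ Icc 0 R, |h₁ r - h₂ r| ≤ D * Real.exp (M * r)) →
      ∀ r ∈ Icc 0 R, |Φ a h₁ r - Φ b h₂ r| ≤
        (1 - θ / Lam) * D * Real.exp (M * r) + (del + κ) / Lam * |a - b| := by
    intro a b h₁ h₂ D hh₁ hh₂ hD hb r hr
    have hb' : ∀ s ∈ Icc 0 r, |h₁ s - h₂ s| ≤ D * Real.exp (M * s) :=
      fun s hs => hb s ⟨hs.1, hs.2.trans hr.2⟩
    have hA := abs_radAvg_le K hM0.le hD hr.1 hb'
    have hw := abs_mul_radAvg_le K hM0 hD hr.1 hb'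
    have hU := abs_radPrimitive_sub_le K a b hh₁ hh₂ hM1 hD hr.1 hb'
    rw [← radAvg_sub K hh₁ hh₂] at hA hw
    rw [mul_sub] at hw
    set D' := D * Real.exp (M * r) with hD'
    have hD'0 : 0 ≤ D' := by positivity
    obtain ⟨hF₁, hF₂⟩ := hF2 (h₁ r - K * radAvg K h₁ r) (radAvg K h₁ r) (r * radAvg K h₁ r)
      (radPrimitive K a h₁ r) (h₂ r - K * radAvg K h₂ r) (radAvg K h₂ r) (r * radAvg K h₂ r)
      (radPrimitive K b h₂ r) (π r) (hπR r)
    have hm : h₁ r - K * radAvg K h₁ r - (h₂ r - K * radAvg K h₂ r) =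
        (h₁ r - h₂ r) - K * (radAvg K h₁ r - radAvg K h₂ r) := by ring
    rw [hm] at hF₁ hF₂
    rw [sub_sub] at hF₁
    rw [add_assoc] at hF₂
    have hP := abs_sub_le_of_Pucci hN hlam hLam hK (hb r hr) hA hF₁ hF₂
    have hΦe : Φ a h₁ r - Φ b h₂ r = ((Lam * (h₁ r - h₂ r) - (F a h₁ r - F b h₂ r)) +
        κ * (radPrimitive K a h₁ r - radPrimitive K b h₂ r)) / Lam := by
      simp only [Φ]
      field_simp
      ring
    rw [hΦe, abs_div, abs_of_pos hLam0, div_le_iff₀ hLam0]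
    refine (abs_add_le _ _).trans ?_
    rw [abs_mul, abs_of_nonneg hκ]
    refine (add_le_add hP (mul_le_mul_of_nonneg_left hU hκ)).trans ?_
    have e1 := mul_le_mul_of_nonneg_left hw hgam.le
    have e2 := mul_le_mul_of_nonneg_left hU hdel.le
    have e3 : gam * (D' / M) + del * (D' / M) + κ * (D' / M) ≤ θ * D' := by
      have := mul_le_mul_of_nonneg_right hMθ hD'0
      calc _ = (gam + del + κ) / M * D' := by ring
        _ ≤ _ := this
    have e4 : ((1 - θ / Lam) * D * Real.exp (M * r) + (del + κ) / Lam * |a - b|) * Lam =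
        (Lam - θ) * D' + (del + κ) * |a - b| := by
      rw [hD']
      field_simp
    rw [e4, hθ2]
    linarith
  have hq0 : 0 ≤ 1 - θ / Lam := sub_nonneg.2 ((div_le_one hLam0).2 hθL)
  have hq1 : 1 - θ / Lam < 1 := by
    have := div_pos hθ0 hLam0
    linarith
  obtain ⟨H, hHc, hHfix, hHlip⟩ := exists_fixedPoint_weighted (C := (del + κ) / Lam) hR.le hM0.le
    hq0 hq1 (by positivity) Φ hΦ hlip
  refine ⟨fun a => radPrimitive K a (H a), fun a r => r * radAvg K (H a) r,
    fun a r => H a r - K * radAvg K (H a) r, fun a => ⟨⟨?_, ?_, ?_, ?_⟩, ?_, ?_, ?_⟩, ?_⟩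
  · exact fun r _ => (hasDerivAt_radPrimitive K a (hHc a) r).hasDerivWithinAt
  · exact (continuous_id.mul (continuous_radAvg K (hHc a))).continuousOn
  · exact fun r hr => hasDerivAt_mul_radAvg K (hHc a) hr.1
  · exact ((hHc a).sub (continuous_const.mul (continuous_radAvg K (hHc a)))).continuousOn
  · intro r hr
    have hr' := Ioo_subset_Icc_self hr
    have h := hHfix a r hr'
    simp only [Φ, F, hπe r hr', sub_eq_self, div_eq_zero_iff, hLam0.ne', or_false] at h
    rw [mul_div_cancel_left₀ _ hr.1.ne']
    linarith
  · simp
  · simp [radPrimitive]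
  · set L := (del + κ) / Lam / (1 - (1 - θ / Lam)) with hL
    have hL0 : 0 ≤ L := div_nonneg (by positivity) (by linarith)
    refine LipschitzWith.continuous (K := Real.toNNReal (1 + L * Real.exp (M * R) / M))
      (LipschitzWith.of_dist_le_mul fun a b => ?_)
    rw [Real.coe_toNNReal _ (by positivity), Real.dist_eq, Real.dist_eq]
    refine (abs_radPrimitive_sub_le K a b (hHc a) (hHc b) hM1 (D := L * |a - b|) (by positivity)
      hR.le (hHlip a b)).trans (le_of_eq (by ring))

/-- Past a critical point where it is positive, the difference of two solutions stays above its
value there. -/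
lemma sub_le_sub_of_radial_solutions (hN : 1 ≤ N) (hlam : 0 < lam) (hgam : 0 < gam)
    (hF2 : ∀ m l p u m' l' p' u' : ℝ, ∀ r ∈ Icc (0 : ℝ) R,
      FF m l p u r - FF m' l' p' u' r
        ≤ Pplus N lam Lam (m - m') (l - l') + gam * |p - p'| + del * |u - u'|)
    {f u u' u'' v v' v'' : ℝ → ℝ} (hu : RadC2 0 R u u' u'') (hv : RadC2 0 R v v' v'')
    (hue : ∀ r ∈ Ioo (0 : ℝ) R, FF (u'' r) (u' r / r) (u' r) (u r) r - (del + 1) * u r = f r)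
    (hve : ∀ r ∈ Ioo (0 : ℝ) R, FF (v'' r) (v' r / r) (v' r) (v r) r - (del + 1) * v r = f r)
    {t₀ : ℝ} (ht₀ : t₀ ∈ Icc 0 R) (hpos : v t₀ < u t₀) (hcrit : u' t₀ = v' t₀) :
    u t₀ - v t₀ ≤ u R - v R := by
  have hsub : Icc t₀ R ⊆ Icc 0 R := Icc_subset_Icc_left ht₀.1
  refine le_of_second_deriv_gt (w := fun r => u r - v r) (w' := fun r => u' r - v' r)
    (w'' := fun r => u'' r - v'' r) (C := gam / lam) (t := R) (t₀ := t₀) (R := R)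
    (fun r hr => ((hu.1 r (hsub hr)).mono hsub).sub ((hv.1 r (hsub hr)).mono hsub))
    ((hu.2.1.mono hsub).sub (hv.2.1.mono hsub)) ?_ (sub_pos.2 hpos) (sub_eq_zero.2 hcrit) ?_
    ⟨ht₀.2, le_rfl⟩
  · intro r hr
    have hr' : r ∈ Ioo 0 R := ⟨ht₀.1.trans_lt hr.1, hr.2⟩
    exact (hu.2.2.1 r hr').sub (hv.2.2.1 r hr')
  · intro r hr hw hw'
    have hr' : r ∈ Ioo 0 R := ⟨ht₀.1.trans_lt hr.1, hr.2⟩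
    have h := hF2 (u'' r) (u' r / r) (u' r) (u r) (v'' r) (v' r / r) (v' r) (v r) r
      (Ioo_subset_Icc_self hr')
    have h₁ := hue r hr'
    have h₂ := hve r hr'
    refine lt_of_lt_Pplus (Lam := Lam) (y := u' r / r - v' r / r) hN hlam hgam hw ?_ hw' ?_
    · rw [← sub_div]
      exact div_nonpos_of_nonpos_of_nonneg hw' hr'.1.le
    · rw [abs_of_pos hw] at h
      linarith

/-- Comparison for the radial Dirichlet problem. -/
lemma radial_solution_le (hN : 1 ≤ N) (hR : 0 < R) (hlam : 0 < lam) (hgam : 0 < gam)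
    (hF2 : ∀ m l p u m' l' p' u' : ℝ, ∀ r ∈ Icc (0 : ℝ) R,
      FF m l p u r - FF m' l' p' u' r
        ≤ Pplus N lam Lam (m - m') (l - l') + gam * |p - p'| + del * |u - u'|)
    {f u u' u'' v v' v'' : ℝ → ℝ} (hu : RadC2 0 R u u' u'') (hv : RadC2 0 R v v' v'')
    (hue : ∀ r ∈ Ioo (0 : ℝ) R, FF (u'' r) (u' r / r) (u' r) (u r) r - (del + 1) * u r = f r)
    (hve : ∀ r ∈ Ioo (0 : ℝ) R, FF (v'' r) (v' r / r) (v' r) (v r) r - (del + 1) * v r = f r)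
    (h0 : u' 0 = v' 0) (hbd : u R = v R) {r : ℝ} (hr : r ∈ Icc 0 R) : u r ≤ v r := by
  by_contra! hlt
  have hd : ∀ s ∈ Icc 0 R,
      HasDerivWithinAt (fun s => u s - v s) (u' s - v' s) (Icc 0 R) s :=
    fun s hs => (hu.1 s hs).sub (hv.1 s hs)
  obtain ⟨t, ht, hmax⟩ := isCompact_Icc.exists_isMaxOn (nonempty_Icc.2 hR.le)
    fun s hs => (hd s hs).continuousWithinAt
  have hrt : u r - v r ≤ u t - v t := hmax hr
  have htR : t < R := lt_of_le_of_ne ht.2 (by rintro rfl; linarith)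
  have hcrit : u' t = v' t := by
    rcases ht.1.eq_or_lt with rfl | h
    · exact h0
    · have hnhds : Icc 0 R ∈ nhds t := Icc_mem_nhds h htR
      exact sub_eq_zero.1
        ((hmax.isLocalMax hnhds).hasDerivAt_eq_zero ((hd t ht).hasDerivAt hnhds))
  have := sub_le_sub_of_radial_solutions hN hlam hgam hF2 hu hv hue hve ht (by linarith) hcrit
  linarith

end RadialOperator

/-- there is `κ > 0` such that the radial Dirichlet problem
`𝓕(u'',u'/r,u',u,r) - κ u = f` on `(0,R)`, `u'(0) = 0`, `u(R) = 0`, is uniquely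
solvable for every continuous right-hand side `f`. -/
theorem stmt_15
    (N : ℕ) (hN : 1 ≤ N) (R lam Lam gam del : ℝ) (hR : 0 < R)
    (hlam : 0 < lam) (hLam : lam ≤ Lam) (hgam : 0 < gam) (hdel : 0 < del)
    (FF : ℝ → ℝ → ℝ → ℝ → ℝ → ℝ)
    (hFcont : ContinuousOn
      (fun z : ℝ × ℝ × ℝ × ℝ × ℝ => FF z.1 z.2.1 z.2.2.1 z.2.2.2.1 z.2.2.2.2)
      {z : ℝ × ℝ × ℝ × ℝ × ℝ | z.2.2.2.2 ∈ Icc 0 R})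
    (hF1 : ∀ s : ℝ, 0 ≤ s → ∀ m l p u : ℝ, ∀ r ∈ Icc (0 : ℝ) R,
      FF (s * m) (s * l) (s * p) (s * u) r = s * FF m l p u r)
    (hF2 : ∀ m l p u m' l' p' u' : ℝ, ∀ r ∈ Icc (0 : ℝ) R,
      Pminus N lam Lam (m - m') (l - l') - gam * |p - p'| - del * |u - u'|
          ≤ FF m l p u r - FF m' l' p' u' r ∧
        FF m l p u r - FF m' l' p' u' r
          ≤ Pplus N lam Lam (m - m') (l - l') + gam * |p - p'| + del * |u - u'|)
    (hF3 : ∀ m l p u m' l' p' u' : ℝ, ∀ r ∈ Icc (0 : ℝ) R,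
      -FF (m' - m) (l' - l) (p' - p) (u' - u) r ≤ FF m l p u r - FF m' l' p' u' r ∧
        FF m l p u r - FF m' l' p' u' r ≤ FF (m - m') (l - l') (p - p') (u - u') r)
    :
    ∃ κ : ℝ, 0 < κ ∧
      ∀ f : ℝ → ℝ, ContinuousOn f (Icc 0 R) →
        ∃ u u' u'' : ℝ → ℝ,
          (RadC2 0 R u u' u'' ∧
            (∀ r ∈ Ioo (0 : ℝ) R,
              FF (u'' r) (u' r / r) (u' r) (u r) r - κ * u r = f r) ∧
            u' 0 = 0 ∧ u R = 0) ∧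
          ∀ v v' v'' : ℝ → ℝ,
            RadC2 0 R v v' v'' →
            (∀ r ∈ Ioo (0 : ℝ) R,
              FF (v'' r) (v' r / r) (v' r) (v r) r - κ * v r = f r) →
            v' 0 = 0 → v R = 0 →
            ∀ r ∈ Icc (0 : ℝ) R, v r = u r := by
  have hF2' := fun m l p u m' l' p' u' r hr => (hF2 m l p u m' l' p' u' r hr).2
  refine ⟨del + 1, by linarith, fun f hf => ?_⟩
  obtain ⟨u, u', u'', hu, huR⟩ := exists_initialValue (κ := del + 1) hN hR hlam hLam hgam hdel
    hFcont hF2 (by linarith) hf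
  have hmono : ∀ a b, b < a → a - b ≤ u a R - u b R := by
    intro a b hab
    obtain ⟨ha, hae, ha', ha0⟩ := hu a
    obtain ⟨hb, hbe, hb', hb0⟩ := hu b
    have := sub_le_sub_of_radial_solutions hN hlam hgam hF2' ha hb hae hbe
      (left_mem_Icc.2 hR.le) (by rwa [ha0, hb0]) (ha'.trans hb'.symm)
    rwa [ha0, hb0] at this
  have hpos := hmono (|u 0 R| + 1) 0 (by positivity)
  have hneg := hmono 0 (-(|u 0 R| + 1)) (by linarith [abs_nonneg (u 0 R)])
  obtain ⟨a, ha⟩ : ∃ a, u a R = 0 :=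
    mem_range_of_exists_le_of_exists_ge huR
      ⟨-(|u 0 R| + 1), by linarith [le_abs_self (u 0 R)]⟩
      ⟨|u 0 R| + 1, by linarith [neg_abs_le (u 0 R)]⟩
  obtain ⟨hua, hue, hu', -⟩ := hu a
  refine ⟨u a, u' a, u'' a, ⟨hua, hue, hu', ha⟩, ?_⟩
  intro v v' v'' hv hve hv' hvR r hr
  exact le_antisymm
    (radial_solution_le hN hR hlam hgam hF2' hv hua hve hue (hv'.trans hu'.symm)
      (hvR.trans ha.symm) hr)
    (radial_solution_le hN hR hlam hgam hF2' hua hv hue hve (hu'.trans hv'.symm)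
      (ha.trans hvR.symm) hr)
end
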